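/- Let d ≥ 1, 0 < s < 1, and let f : [−1,1] → ℝ be C^{1,α} with α > max{0, 1−2s}. Let u be a stable solution of (−Δ)^s u = f(u) in ℝ^d with |u| ≤ 1. Then there is a constant C = C(d,s) such that ∫_{B_{1/2}} |∇u(x)| dx ≤ C · ( 1 + √(J^s(u, B₁)) ). -/

import Mathlib

open MeasureTheory Metric Set
open scoped ENNReal NNReal

/-- The fractional `s`-energy `J^s(u,Ω)` of `u : ℝ^d → ℝ` on an open set `Ω`:
`J^s(u,Ω) = ∬_{(ℝ^d×ℝ^d)∖(Ωᶜ×Ωᶜ)} |u(x)−u(y)|²/|x−y|^{d+2s} dy dx`, valued in `[0,∞]`. -/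
noncomputable def Js (d : ℕ) (s : ℝ) (u : EuclideanSpace ℝ (Fin d) → ℝ)
    (Ω : Set (EuclideanSpace ℝ (Fin d))) : ℝ≥0∞ :=
  ∫⁻ p : EuclideanSpace ℝ (Fin d) × EuclideanSpace ℝ (Fin d) in (Ωᶜ ×ˢ Ωᶜ)ᶜ,
    ENNReal.ofReal ((u p.1 - u p.2)^2 / ‖p.1 - p.2‖ ^ ((d : ℝ) + 2*s))

/-- The normalizing constant `C(d,s) = 2^{2s} Γ(d/2+s) / (π^{d/2} |Γ(−s)|)` of the fractional
Laplacian, which normalizes its Fourier symbol to `|ξ|^{2s}`. -/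
noncomputable def fracC (d : ℕ) (s : ℝ) : ℝ :=
  2 ^ (2*s) * Real.Gamma ((d : ℝ)/2 + s) / (Real.pi ^ ((d : ℝ)/2) * |Real.Gamma (-s)|)

/-- `f : [−1,1] → ℝ` is `C^{1,α}`: it has derivative `f'` on `[−1,1]` and `f'` is
`α`-Hölder continuous on `[−1,1]`. -/
def IsC1Alpha (f f' : ℝ → ℝ) (α : ℝ) : Prop :=
  (∀ x ∈ Set.Icc (-1 : ℝ) 1, HasDerivAt f (f' x) x) ∧
  ∃ Cα : ℝ, 0 ≤ Cα ∧ ∀ x ∈ Set.Icc (-1 : ℝ) 1, ∀ y ∈ Set.Icc (-1 : ℝ) 1,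
    |f' x - f' y| ≤ Cα * |x - y| ^ α

/-- `u ∈ C²(ℝ^d)` with `|u| ≤ 1` is a stable solution of `(−Δ)^s u = f(u)` in `ℝ^d`:
the equation `(C(d,s)/2)∫ (2u(x)−u(x+y)−u(x−y))/|y|^{d+2s} dy = f(u(x))` holds pointwise and
for every `η ∈ C_c^∞(ℝ^d)` one has
`(C(d,s)/2) ∬ |η(x)−η(y)|²/|x−y|^{d+2s} dx dy ≥ ∫ f'(u(x)) η(x)² dx`. -/
def IsStableSolution (d : ℕ) (s : ℝ) (f f' : ℝ → ℝ)
    (u : EuclideanSpace ℝ (Fin d) → ℝ) : Prop :=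
  ContDiff ℝ 2 u ∧ (∀ x, |u x| ≤ 1) ∧
  (∀ x : EuclideanSpace ℝ (Fin d),
    fracC d s / 2 * ∫ y : EuclideanSpace ℝ (Fin d),
      (2 * u x - u (x + y) - u (x - y)) / ‖y‖ ^ ((d : ℝ) + 2*s) = f (u x)) ∧
  (∀ η : EuclideanSpace ℝ (Fin d) → ℝ, ContDiff ℝ (⊤ : ℕ∞) η → HasCompactSupport η →
    ∫ x : EuclideanSpace ℝ (Fin d), f' (u x) * (η x)^2 ≤
      fracC d s / 2 * ∫ x : EuclideanSpace ℝ (Fin d), ∫ y : EuclideanSpace ℝ (Fin d),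
        (η x - η y)^2 / ‖x - y‖ ^ ((d : ℝ) + 2*s))

open scoped Convolution Topology


/-- Euclidean space. -/
abbrev EE (d : ℕ) := EuclideanSpace ℝ (Fin d)

/-- kernel -/
noncomputable def kk {d : ℕ} (p : ℝ) (z : EE d) : ℝ := (‖z‖ ^ p)⁻¹

/-- truncated kernel -/
noncomputable def kap {d : ℕ} (p : ℝ) (z : EE d) : ℝ := min 1 (‖z‖ ^ 2) * kk p z

lemma kk_nonneg {d : ℕ} (p : ℝ) (z : EE d) : 0 ≤ kk p z := by
  unfold kk; positivity

lemma kap_nonneg {d : ℕ} (p : ℝ) (z : EE d) : 0 ≤ kap p z := by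
  unfold kap; have := kk_nonneg p z; positivity

lemma kk_neg {d : ℕ} (p : ℝ) (z : EE d) : kk p (-z) = kk p z := by simp [kk]
lemma kap_neg {d : ℕ} (p : ℝ) (z : EE d) : kap p (-z) = kap p z := by simp [kap, kk_neg]

lemma kk_meas {d : ℕ} (p : ℝ) : Measurable (kk p : EE d → ℝ) := by
  unfold kk; fun_prop
lemma kap_meas {d : ℕ} (p : ℝ) : Measurable (kap p : EE d → ℝ) := by
  have := kk_meas (d := d) p
  unfold kap; fun_prop

lemma kap_integrable {d : ℕ} (hd : 1 ≤ d) {s : ℝ} (hs0 : 0 < s) (hs1 : s < 1) :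
    Integrable (kap ((d : ℝ) + 2 * s) : EE d → ℝ) := by
  have : Nonempty (Fin d) := ⟨⟨0, hd⟩⟩
  have key := integrable_fun_norm_addHaar (E := EE d) volume
    (f := fun r : ℝ => min 1 (r ^ 2) * (r ^ ((d : ℝ) + 2 * s))⁻¹)
  refine key.2 ?_
  rw [finrank_euclideanSpace_fin, ← Ioc_union_Ioi_eq_Ioi (zero_le_one' ℝ)]
  have hdr : ((d - 1 : ℕ) : ℝ) = (d : ℝ) - 1 := by push_cast [hd]; ring
  refine IntegrableOn.union ?_ ?_
  · have h1 : IntegrableOn (fun r : ℝ => r ^ (1 - 2 * s)) (Ioc 0 1) := by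
      rw [← intervalIntegrable_iff_integrableOn_Ioc_of_le zero_le_one]
      exact intervalIntegral.intervalIntegrable_rpow' (by linarith)
    refine h1.congr_fun ?_ measurableSet_Ioc
    intro r hr
    have hr0 : 0 < r := hr.1
    have : min 1 (r ^ 2) = r ^ 2 := min_eq_right (by nlinarith [hr.1, hr.2])
    simp only [this, smul_eq_mul]
    rw [← Real.rpow_natCast r (d - 1), hdr, ← Real.rpow_natCast r 2, ← Real.rpow_neg hr0.le,
      ← Real.rpow_add hr0, ← Real.rpow_add hr0]
    congr 1; push_cast; ring
  · have h1 : IntegrableOn (fun r : ℝ => r ^ (-1 - 2 * s)) (Ioi 1) :=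
      integrableOn_Ioi_rpow_of_lt (by linarith) zero_lt_one
    refine h1.congr_fun ?_ measurableSet_Ioi
    intro r hr
    have hr1 : 1 < r := hr
    have hr0 : 0 < r := by linarith
    have : min 1 (r ^ 2) = 1 := min_eq_left (by nlinarith)
    simp only [this, smul_eq_mul, one_mul]
    rw [← Real.rpow_natCast r (d - 1), hdr, ← Real.rpow_neg hr0.le,
      ← Real.rpow_add hr0]
    congr 1; ring

/-- indicator of the unit ball -/
noncomputable def ind {d : ℕ} (x : EE d) : ℝ := (ball (0 : EE d) 1).indicator (fun _ => (1:ℝ)) x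

lemma ind_nonneg {d : ℕ} (x : EE d) : 0 ≤ ind x := indicator_nonneg (by simp) _
lemma ind_eq_one {d : ℕ} {x : EE d} (h : x ∈ ball (0 : EE d) 1) : ind x = 1 := by simp [ind, h]
lemma ind_integrable {d : ℕ} : Integrable (ind : EE d → ℝ) := by
  unfold ind
  exact (integrable_indicator_iff measurableSet_ball).2 (by simp [integrableOn_const_iff, measure_ball_lt_top])

/-- dominating function -/
noncomputable def dom {d : ℕ} (p : ℝ) (q : EE d × EE d) : ℝ :=
  (ind q.1 + ind q.2) * kap p (q.1 - q.2)

lemma dom_nonneg {d : ℕ} (p : ℝ) (q : EE d × EE d) : 0 ≤ dom p q := 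
  mul_nonneg (add_nonneg (ind_nonneg _) (ind_nonneg _)) (kap_nonneg _ _)

lemma integrable_prod_sub {d : ℕ} {a b : EE d → ℝ} (ha : Integrable a) (hb : Integrable b) :
    Integrable (fun q : EE d × EE d => a q.2 * b (q.1 - q.2)) := by
  exact Integrable.convolution_integrand (ContinuousLinearMap.mul ℝ ℝ) ha hb

lemma integrable_prod_sub' {d : ℕ} {a b : EE d → ℝ} (ha : Integrable a) (hb : Integrable b) :
    Integrable (fun q : EE d × EE d => a q.1 * b (q.1 - q.2)) := by
  have h := integrable_prod_sub ha hb.comp_neg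
  have h2 := h.swap
  refine h2.congr (Filter.Eventually.of_forall fun q => ?_)
  simp 

lemma dom_integrable {d : ℕ} (hd : 1 ≤ d) {s : ℝ} (hs0 : 0 < s) (hs1 : s < 1) :
    Integrable (dom ((d : ℝ) + 2 * s) : EE d × EE d → ℝ) := by
  have hk := kap_integrable hd hs0 hs1
  have h := (integrable_prod_sub' ind_integrable hk).add (integrable_prod_sub ind_integrable hk)
  refine h.congr (Filter.Eventually.of_forall fun q => ?_)
  simp [dom, add_mul]

lemma integrable_of_dom {d : ℕ} (hd : 1 ≤ d) {s : ℝ} (hs0 : 0 < s) (hs1 : s < 1)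
    {F : EE d × EE d → ℝ} (hF : AEStronglyMeasurable F) (A : ℝ)
    (hA : ∀ q, |F q| ≤ A * dom ((d : ℝ) + 2 * s) q) : Integrable F :=
  ((dom_integrable hd hs0 hs1).const_mul A).mono' hF (Filter.Eventually.of_forall hA)


lemma rpow_first (b : ℝ) : ∃ C : ℝ, 0 ≤ C ∧ ∀ t : ℝ, |t| ≤ 9/16 → |(1 + t) ^ b - 1| ≤ C * |t| := by
  have hc : ContinuousOn (fun t : ℝ => b * (1 + t) ^ (b - 1)) (Icc (-(9/16)) (9/16)) := by
    refine ContinuousOn.mul continuousOn_const ?_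
    refine ContinuousOn.rpow_const (by fun_prop) ?_
    intro x hx; left; linarith [hx.1]
  obtain ⟨C, hC⟩ := isCompact_Icc.exists_bound_of_continuousOn hc
  refine ⟨C, (norm_nonneg _).trans (hC 0 (by constructor <;> norm_num)), fun t ht => ?_⟩
  have := (convex_Icc (-(9/16) : ℝ) (9/16)).norm_image_sub_le_of_norm_hasDerivWithin_le
    (f := fun t : ℝ => (1 + t) ^ b) (f' := fun t : ℝ => b * (1 + t) ^ (b - 1)) (C := C)
    (x := 0) (y := t) ?_ hC (by constructor <;> norm_num) (abs_le.1 ht)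
  · simpa using this
  · intro x hx
    have h1 : HasDerivAt (fun t : ℝ => 1 + t) 1 x := by simpa using (hasDerivAt_id x).const_add 1
    have := h1.rpow_const (p := b) (Or.inl (by linarith [hx.1]))
    exact (by simpa using this : HasDerivAt _ _ _).hasDerivWithinAt

lemma rpow_second (b : ℝ) : ∃ C : ℝ, 0 ≤ C ∧ ∀ t : ℝ, |t| ≤ 9/16 →
    |(1 + t) ^ b - 1 - b * t| ≤ C * t ^ 2 := by
  obtain ⟨C, hC0, hC⟩ := rpow_first (b - 1)
  refine ⟨|b| * C, by positivity, fun t ht => ?_⟩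
  have := (convex_Icc (-|t|) |t|).norm_image_sub_le_of_norm_hasDerivWithin_le
    (f := fun t : ℝ => (1 + t) ^ b - b * t) (f' := fun t : ℝ => b * ((1 + t) ^ (b - 1) - 1))
    (C := |b| * C * |t|)
    (x := 0) (y := t) ?_ ?_ (by constructor <;> simp) (abs_le.1 le_rfl)
  · rw [← sq_abs t]
    calc |(1 + t) ^ b - 1 - b * t| = ‖((1 + t) ^ b - b * t) - ((1 + 0) ^ b - b * 0)‖ := by
          rw [Real.norm_eq_abs]; congr 1; simp; ring
      _ ≤ |b| * C * |t| * ‖t - 0‖ := this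
      _ = _ := by rw [sub_zero, Real.norm_eq_abs]; ring
  · intro x hx
    have hx' : |x| ≤ |t| := abs_le.2 hx
    have hx2 := abs_le.1 (hx'.trans ht)
    have h1 : HasDerivAt (fun t : ℝ => 1 + t) 1 x := by simpa using (hasDerivAt_id x).const_add 1
    have h2 := h1.rpow_const (p := b) (Or.inl (by linarith [hx2.1]))
    have h3 := h2.sub ((hasDerivAt_id x).const_mul b)
    refine (HasDerivAt.congr_deriv h3 ?_).hasDerivWithinAt
    simp; ring
  · intro x hx
    have hx' : |x| ≤ |t| := abs_le.2 hx
    rw [norm_mul, Real.norm_eq_abs, Real.norm_eq_abs, mul_assoc]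
    exact mul_le_mul_of_nonneg_left ((hC x (hx'.trans ht)).trans
      (mul_le_mul_of_nonneg_left hx' hC0)) (abs_nonneg b)

lemma kk_scale {d : ℕ} (p : ℝ) (z h : EE d) (hz : z ≠ 0) (hh : 4 * ‖h‖ ≤ ‖z‖) :
    |(2 * inner ℝ z h + ‖h‖ ^ 2) / ‖z‖ ^ 2| ≤ 9 / 4 * (‖h‖ / ‖z‖) ∧
    kk p (z + h) = kk p z * (1 + (2 * inner ℝ z h + ‖h‖ ^ 2) / ‖z‖ ^ 2) ^ (-p / 2) := by
  have hz0 : 0 < ‖z‖ := norm_pos_iff.2 hz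
  have hin := abs_real_inner_le_norm z h
  have hn : 0 ≤ ‖h‖ := norm_nonneg h
  have h1 : |(2 * inner ℝ z h + ‖h‖ ^ 2) / ‖z‖ ^ 2| ≤ 9 / 4 * (‖h‖ / ‖z‖) := by
    rw [abs_div, abs_of_pos (by positivity : 0 < ‖z‖ ^ 2), div_le_iff₀ (by positivity)]
    have : 9 / 4 * (‖h‖ / ‖z‖) * ‖z‖ ^ 2 = 9 / 4 * ‖h‖ * ‖z‖ := by field_simp
    rw [this]
    have := abs_le.1 hin
    rw [abs_le]; constructor <;> nlinarith
  refine ⟨h1, ?_⟩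
  have hr : ‖h‖ / ‖z‖ ≤ 1 / 4 := by rw [div_le_iff₀ hz0]; linarith
  set τ := (2 * inner ℝ z h + ‖h‖ ^ 2) / ‖z‖ ^ 2 with hτ
  have hpos : 0 < 1 + τ := by have := (abs_le.1 h1).1; linarith
  have hsq : ‖z + h‖ ^ 2 = ‖z‖ ^ 2 * (1 + τ) := by
    rw [norm_add_sq_real, hτ]; field_simp; ring
  have e1 : ∀ w : EE d, kk p w = (‖w‖ ^ 2) ^ (-p / 2) := by
    intro w
    unfold kk
    rw [← Real.rpow_natCast, ← Real.rpow_mul (norm_nonneg _), ← Real.rpow_neg (norm_nonneg _)]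
    congr 1; push_cast; ring
  rw [e1, e1, hsq, Real.mul_rpow (by positivity) hpos.le]

lemma kk_diff {d : ℕ} (p : ℝ) : ∃ C : ℝ, 0 ≤ C ∧ ∀ z h : EE d, z ≠ 0 → 4 * ‖h‖ ≤ ‖z‖ →
    |kk p z - kk p (z + h)| ≤ C * (‖h‖ / ‖z‖) * kk p z ∧
    |2 * kk p z - kk p (z + h) - kk p (z - h)| ≤ C * (‖h‖ / ‖z‖) ^ 2 * kk p z := by
  obtain ⟨C1, hC1, h1⟩ := rpow_first (-p / 2)
  obtain ⟨C2, hC2, h2⟩ := rpow_second (-p / 2)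
  refine ⟨9 / 4 * C1 + (C2 * (81 / 8) + |p|), by positivity, fun z h hz hh => ?_⟩
  have hz0 : 0 < ‖z‖ := norm_pos_iff.2 hz
  obtain ⟨a1, b1⟩ := kk_scale p z h hz hh
  obtain ⟨a2, b2⟩ := kk_scale p z (-h) hz (by simpa using hh)
  have hsum : (2 * inner ℝ z h + ‖h‖ ^ 2) / ‖z‖ ^ 2 + (2 * inner ℝ z (-h) + ‖-h‖ ^ 2) / ‖z‖ ^ 2
      = 2 * (‖h‖ / ‖z‖) ^ 2 := by
    rw [inner_neg_right, norm_neg]; field_simp; ring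
  rw [norm_neg] at a2
  rw [← sub_eq_add_neg, norm_neg] at b2
  rw [norm_neg] at hsum
  set τ := (2 * inner ℝ z h + ‖h‖ ^ 2) / ‖z‖ ^ 2
  set τ' := (2 * inner ℝ z (-h) + ‖h‖ ^ 2) / ‖z‖ ^ 2
  have hr : ‖h‖ / ‖z‖ ≤ 1 / 4 := by rw [div_le_iff₀ hz0]; linarith
  have hr0 : 0 ≤ ‖h‖ / ‖z‖ := by positivity
  set r := ‖h‖ / ‖z‖
  have hk := kk_nonneg p z
  have f1 := h1 τ (by linarith)
  have f2 := h2 τ (by linarith)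
  have f3 := h2 τ' (by linarith)
  have g1 : τ ^ 2 ≤ 81 / 16 * r ^ 2 := by rw [← sq_abs]; nlinarith [abs_nonneg τ]
  have g2 : τ' ^ 2 ≤ 81 / 16 * r ^ 2 := by rw [← sq_abs]; nlinarith [abs_nonneg τ']
  rw [b1, b2]
  constructor
  · have : kk p z - kk p z * (1 + τ) ^ (-p / 2) = -(((1 + τ) ^ (-p / 2) - 1) * kk p z) := by ring
    rw [this, abs_neg, abs_mul, abs_of_nonneg hk]
    refine mul_le_mul_of_nonneg_right ?_ hk
    have h3 : C1 * |τ| ≤ C1 * (9 / 4 * r) := mul_le_mul_of_nonneg_left a1 hC1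
    have h4 : 0 ≤ (C2 * (81 / 8) + |p|) * r := by positivity
    nlinarith
  · have : 2 * kk p z - kk p z * (1 + τ) ^ (-p / 2) - kk p z * (1 + τ') ^ (-p / 2)
      = -((((1 + τ) ^ (-p / 2) - 1 - (-p / 2) * τ) + ((1 + τ') ^ (-p / 2) - 1 - (-p / 2) * τ')
        + (-p / 2) * (τ + τ')) * kk p z) := by ring
    rw [this, abs_neg, abs_mul, abs_of_nonneg hk]
    refine mul_le_mul_of_nonneg_right ?_ hk
    refine (abs_add_three _ _ _).trans ?_
    have e : |(-p / 2) * (τ + τ')| = |p| * r ^ 2 := by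
      rw [hsum, abs_mul, abs_div, abs_neg, abs_of_nonneg (by positivity : 0 ≤ 2 * r ^ 2)]
      simp; ring
    rw [e]
    have h3 := mul_le_mul_of_nonneg_left g1 hC2
    have h4 := mul_le_mul_of_nonneg_left g2 hC2
    have h5 : 0 ≤ 9 / 4 * C1 * r ^ 2 := by positivity
    nlinarith


lemma loc_lip {d : ℕ} {F : Type*} [NormedAddCommGroup F] [NormedSpace ℝ F] {W : EE d → F}
    (hW : ContDiff ℝ 1 W) (R : ℝ) :
    ∃ L : ℝ, 0 ≤ L ∧ ∀ x ∈ closedBall (0 : EE d) R, ∀ y ∈ closedBall (0 : EE d) R,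
      ‖W x - W y‖ ≤ L * ‖x - y‖ := by
  have hc : Continuous (fderiv ℝ W) := hW.continuous_fderiv one_ne_zero
  obtain ⟨C, hC⟩ := (isCompact_closedBall (0 : EE d) R).exists_bound_of_continuousOn hc.continuousOn
  refine ⟨max C 0, le_max_right _ _, fun x hx y hy => ?_⟩
  exact (convex_closedBall (0 : EE d) R).norm_image_sub_le_of_norm_fderiv_le (𝕜 := ℝ)
    (fun z _ => (hW.differentiable one_ne_zero) z) (fun z hz => (hC z hz).trans (le_max_left _ _)) hy hx

lemma second_diff {d : ℕ} {W : EE d → ℝ} (hW : ContDiff ℝ 2 W) {M : ℝ} (hM : ∀ x, |W x| ≤ M) :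
    ∃ A : ℝ, 0 ≤ A ∧ ∀ x ∈ ball (0 : EE d) 1, ∀ z,
      |2 * W x - W (x + z) - W (x - z)| ≤ A * min 1 (‖z‖ ^ 2) := by
  have hM0 : 0 ≤ M := (abs_nonneg _).trans (hM 0)
  have hfd : ContDiff ℝ 1 (fderiv ℝ W) := hW.fderiv_right (by norm_num)
  obtain ⟨L, hL0, hL⟩ := loc_lip hfd 2
  refine ⟨4 * M + 2 * L, by positivity, fun x hx z => ?_⟩
  have hx' : ‖x‖ < 1 := by simpa using hx
  by_cases hz : ‖z‖ ≤ 1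
  · have hmin : min 1 (‖z‖ ^ 2) = ‖z‖ ^ 2 := min_eq_right (by nlinarith [norm_nonneg z])
    rw [hmin]
    have hdiff : Differentiable ℝ W := hW.differentiable two_ne_zero
    have hd : ∀ (w : EE d) (t : ℝ), HasDerivAt (fun t : ℝ => W (x + t • w)) (fderiv ℝ W (x + t • w) w) t := by
      intro w t
      have h1 : HasDerivAt (fun t : ℝ => x + t • w) w t := by
        simpa using ((hasDerivAt_id t).smul_const w).const_add x
      exact (hdiff (x + t • w)).hasFDerivAt.comp_hasDerivAt t h1
    have := (convex_Icc (0 : ℝ) 1).norm_image_sub_le_of_norm_hasDerivWithin_le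
      (f := fun t : ℝ => W (x + t • z) + W (x + t • (-z)))
      (f' := fun t => fderiv ℝ W (x + t • z) z + fderiv ℝ W (x + t • (-z)) (-z))
      (C := 2 * L * ‖z‖ ^ 2) (x := 0) (y := 1)
      (fun t _ => ((hd z t).add (hd (-z) t)).hasDerivWithinAt) ?_ (by simp) (by simp)
    · have e : |2 * W x - W (x + z) - W (x - z)|
        = ‖(W (x + (1:ℝ) • z) + W (x + (1:ℝ) • (-z))) - (W (x + (0:ℝ) • z) + W (x + (0:ℝ) • (-z)))‖ := by
        rw [Real.norm_eq_abs, ← abs_neg]; congr 1; simp [sub_eq_add_neg]; ring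
      rw [e]
      refine this.trans ?_
      simp only [sub_zero, norm_one, mul_one]
      nlinarith [sq_nonneg ‖z‖]
    · intro t ht
      have hmem : ∀ w : EE d, ‖w‖ ≤ 1 → x + t • w ∈ closedBall (0 : EE d) 2 := by
        intro w hw
        rw [mem_closedBall_zero_iff]
        calc ‖x + t • w‖ ≤ ‖x‖ + ‖t • w‖ := norm_add_le _ _
          _ ≤ 1 + 1 := by
            refine add_le_add hx'.le ?_
            rw [norm_smul, Real.norm_eq_abs, abs_of_nonneg ht.1]
            nlinarith [ht.1, ht.2, norm_nonneg w]
          _ = 2 := by norm_num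
      have e : fderiv ℝ W (x + t • z) z + fderiv ℝ W (x + t • (-z)) (-z)
          = (fderiv ℝ W (x + t • z) - fderiv ℝ W (x + t • (-z))) z := by
        simp [sub_eq_add_neg]
      rw [e]
      refine (ContinuousLinearMap.le_opNorm _ _).trans ?_
      have h2 := hL _ (hmem z hz) _ (hmem (-z) (by simpa using hz))
      have e2 : x + t • z - (x + t • (-z)) = (2 * t) • z := by
        rw [smul_neg]; module
      rw [e2, norm_smul, Real.norm_eq_abs, abs_of_nonneg (by linarith [ht.1])] at h2
      have h3 : L * (2 * t * ‖z‖) ≤ L * (2 * ‖z‖) := by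
        refine mul_le_mul_of_nonneg_left ?_ hL0
        nlinarith [ht.1, ht.2, norm_nonneg z]
      nlinarith [norm_nonneg z]
  · have hmin : min 1 (‖z‖ ^ 2) = 1 := min_eq_left (by nlinarith [norm_nonneg z])
    rw [hmin]
    have h1 := abs_le.1 (hM x)
    have h2 := abs_le.1 (hM (x + z))
    have h3 := abs_le.1 (hM (x - z))
    rw [abs_le]; constructor <;> linarith

/-- `ψ` is bounded, Lipschitz, and vanishes off the unit ball. -/
structure LipC {d : ℕ} (ψ : EE d → ℝ) (L : ℝ) : Prop where
  supp : ∀ x, x ∉ ball (0 : EE d) 1 → ψ x = 0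
  lip : ∀ x y, |ψ x - ψ y| ≤ L * ‖x - y‖
  bdd : ∀ x, |ψ x| ≤ L

lemma LipC.nonneg {d : ℕ} {ψ : EE d → ℝ} {L : ℝ} (h : LipC ψ L) : 0 ≤ L :=
  (abs_nonneg _).trans (h.bdd 0)

lemma LipC.cont {d : ℕ} {ψ : EE d → ℝ} {L : ℝ} (h : LipC ψ L) : Continuous ψ := by
  have : LipschitzWith L.toNNReal ψ := by
    refine LipschitzWith.of_dist_le_mul fun x y => ?_
    rw [Real.coe_toNNReal _ h.nonneg, Real.dist_eq, dist_eq_norm]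
    exact h.lip x y
  exact this.continuous

lemma LipC.diff_le {d : ℕ} {ψ : EE d → ℝ} {L : ℝ} (h : LipC ψ L) (x y : EE d) :
    |ψ x - ψ y| ≤ 2 * L * min 1 ‖x - y‖ := by
  have h0 := h.nonneg
  rcases le_total 1 ‖x - y‖ with h1 | h1
  · rw [min_eq_left h1]
    have a := abs_le.1 (h.bdd x); have b := abs_le.1 (h.bdd y)
    rw [abs_le]; constructor <;> linarith
  · rw [min_eq_right h1]
    have := h.lip x y
    nlinarith [norm_nonneg (x - y)]

lemma LipC.zero {d : ℕ} {ψ : EE d → ℝ} {L : ℝ} (h : LipC ψ L) {x y : EE d} (hxy : ¬ (1 ≤ ind x + ind y)) :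
    ψ x = 0 ∧ ψ y = 0 := by
  constructor
  · apply h.supp; intro hx; apply hxy; rw [ind_eq_one hx]; linarith [ind_nonneg y]
  · apply h.supp; intro hx; apply hxy; rw [ind_eq_one hx]; linarith [ind_nonneg x]

lemma min_sq {d : ℕ} (z : EE d) : min 1 ‖z‖ ^ 2 = min 1 (‖z‖ ^ 2) := by
  rcases le_total 1 ‖z‖ with h1 | h1
  · rw [min_eq_left h1, min_eq_left (by nlinarith)]; simp
  · rw [min_eq_right h1, min_eq_right (by nlinarith [norm_nonneg z])]

lemma le_dom {d : ℕ} {p A a : ℝ} {q : EE d × EE d} (hA : 0 ≤ A)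
    (h : 1 ≤ ind q.1 + ind q.2 → |a| ≤ A * min 1 (‖q.1 - q.2‖ ^ 2))
    (h0 : ¬ (1 ≤ ind q.1 + ind q.2) → a = 0) : |a * kk p (q.1 - q.2)| ≤ A * dom p q := by
  by_cases h1 : 1 ≤ ind q.1 + ind q.2
  · rw [abs_mul, abs_of_nonneg (kk_nonneg _ _)]
    unfold dom kap
    have hk := kk_nonneg p (q.1 - q.2)
    calc |a| * kk p (q.1 - q.2) ≤ A * min 1 (‖q.1 - q.2‖ ^ 2) * kk p (q.1 - q.2) := 
          mul_le_mul_of_nonneg_right (h h1) hk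
      _ = A * (1 * (min 1 (‖q.1 - q.2‖ ^ 2) * kk p (q.1 - q.2))) := by ring
      _ ≤ _ := by gcongr
  · rw [h0 h1]; simpa using mul_nonneg hA (dom_nonneg p q)

/-- `W` is bounded, continuous and Lipschitz on the ball of radius 2. -/
structure LocL {d : ℕ} (W : EE d → ℝ) (A : ℝ) : Prop where
  cont : Continuous W
  bdd : ∀ x, |W x| ≤ A
  lip : ∀ x ∈ ball (0 : EE d) 2, ∀ y ∈ ball (0 : EE d) 2, |W x - W y| ≤ A * ‖x - y‖

lemma LocL.nonneg {d : ℕ} {ψ : EE d → ℝ} {L : ℝ} (h : LocL ψ L) : 0 ≤ L :=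
  (abs_nonneg _).trans (h.bdd 0)

lemma ind_cases {d : ℕ} {x y : EE d} (h : 1 ≤ ind x + ind y) : ‖x‖ < 1 ∨ ‖y‖ < 1 := by
  by_contra! hc
  have h1 : ind x = 0 := by simp [ind, hc.1]
  have h2 : ind y = 0 := by simp [ind, hc.2]
  linarith

lemma LocL.diff_le {d : ℕ} {W : EE d → ℝ} {A : ℝ} (hW : LocL W A) {x y : EE d}
    (h : 1 ≤ ind x + ind y) : |W x - W y| ≤ 2 * A * min 1 ‖x - y‖ := by
  have h0 := hW.nonneg
  rcases le_or_gt 1 ‖x - y‖ with h1 | h1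
  · rw [min_eq_left h1]
    have a := abs_le.1 (hW.bdd x); have b := abs_le.1 (hW.bdd y)
    rw [abs_le]; constructor <;> linarith
  · rw [min_eq_right h1.le]
    have hx : ‖x‖ < 2 ∧ ‖y‖ < 2 := by
      have e1 := norm_le_norm_add_norm_sub x y
      have e2 := norm_le_norm_add_norm_sub y x
      rw [norm_sub_rev] at e2
      rcases ind_cases h with h | h <;> constructor <;> linarith
    have := hW.lip x (by simpa using hx.1) y (by simpa using hx.2)
    nlinarith [norm_nonneg (x - y)]

lemma bil_integrable {d : ℕ} (hd : 1 ≤ d) {s : ℝ} (hs0 : 0 < s) (hs1 : s < 1)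
    {W ψ : EE d → ℝ} {A L : ℝ} (hW : LocL W A) (hψ : LipC ψ L) :
    Integrable (fun q : EE d × EE d =>
      (W q.1 - W q.2) * (ψ q.1 - ψ q.2) * kk ((d:ℝ) + 2 * s) (q.1 - q.2)) := by
  have := hW.cont; have := hψ.cont; have := kk_meas (d := d) ((d:ℝ) + 2 * s)
  have hA := hW.nonneg; have hL := hψ.nonneg
  refine integrable_of_dom hd hs0 hs1 (Measurable.aestronglyMeasurable (by fun_prop))
    (4 * A * L) fun q => le_dom (by positivity) ?_ ?_
  · intro h
    rw [abs_mul, ← min_sq]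
    have h1 := hW.diff_le h
    have h2 := hψ.diff_le q.1 q.2
    calc _ ≤ (2 * A * min 1 ‖q.1 - q.2‖) * (2 * L * min 1 ‖q.1 - q.2‖) :=
          mul_le_mul h1 h2 (abs_nonneg _) (by positivity)
      _ = _ := by ring
  · intro h
    simp [hψ.zero h]

lemma weak_form {d : ℕ} (hd : 1 ≤ d) {s : ℝ} (hs0 : 0 < s) (hs1 : s < 1)
    {W ψ : EE d → ℝ} {A L : ℝ} (hW : LocL W A) (hW2 : ContDiff ℝ 2 W) (hψ : LipC ψ L) :
    ∫ x, ψ x * ∫ z, (2 * W x - W (x + z) - W (x - z)) / ‖z‖ ^ ((d:ℝ) + 2 * s) =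
    ∫ q : EE d × EE d, (W q.1 - W q.2) * (ψ q.1 - ψ q.2) * kk ((d:ℝ) + 2 * s) (q.1 - q.2) := by
  set p := (d:ℝ) + 2 * s with hp
  have c1 := hW.cont; have c2 := hψ.cont; have c3 := kk_meas (d := d) p
  have hH := bil_integrable hd hs0 hs1 hW hψ
  rw [← hp] at hH
  obtain ⟨B, hB0, hB⟩ := second_diff hW2 hW.bdd
  have hF : Integrable (fun q : EE d × EE d => 
      ψ q.1 * ((2 * W q.1 - W (q.1 + q.2) - W (q.1 - q.2)) * kk p q.2)) := by
    have hdom : Integrable (fun q : EE d × EE d => L * B * (ind q.1 * kap p q.2)) :=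
      ((ind_integrable).mul_prod (kap_integrable hd hs0 hs1)).const_mul _
    refine hdom.mono' (Measurable.aestronglyMeasurable (by fun_prop)) 
      (Filter.Eventually.of_forall fun q => ?_)
    have hk := kk_nonneg p q.2
    by_cases hq : q.1 ∈ ball (0 : EE d) 1
    · rw [ind_eq_one hq, Real.norm_eq_abs, abs_mul, abs_mul, abs_of_nonneg hk, one_mul, mul_assoc]
      refine mul_le_mul (hψ.bdd _) ?_ (by positivity) hψ.nonneg
      unfold kap
      rw [← mul_assoc]
      exact mul_le_mul_of_nonneg_right (hB _ hq _) hk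
    · rw [hψ.supp _ hq]
      have := hψ.nonneg; have := ind_nonneg q.1; have := kap_nonneg p q.2
      simp only [zero_mul, norm_zero]; positivity
  have e1 : ∫ x, ψ x * ∫ z, (2 * W x - W (x + z) - W (x - z)) / ‖z‖ ^ p
      = ∫ z, ∫ x, ψ x * ((2 * W x - W (x + z) - W (x - z)) * kk p z) := by
    rw [← integral_integral_swap (f := fun x z => ψ x * ((2 * W x - W (x + z) - W (x - z)) * kk p z)) hF]
    congr 1; ext x
    rw [integral_const_mul]; rfl
  have hmp : MeasurePreserving (fun q : EE d × EE d => (q.1, q.1 + q.2)) volume volume :=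
    measurePreserving_prod_add volume volume
  have hH2 : Integrable (fun q : EE d × EE d => 
      (W q.1 - W (q.1 + q.2)) * (ψ q.1 - ψ (q.1 + q.2)) * kk p q.2) := by
    have := hmp.integrable_comp_of_integrable hH
    refine this.congr (Filter.Eventually.of_forall fun q => ?_)
    simp [kk_neg]
  have e2 : ∫ q : EE d × EE d, (W q.1 - W q.2) * (ψ q.1 - ψ q.2) * kk p (q.1 - q.2)
      = ∫ z, ∫ x, (W x - W (x + z)) * (ψ x - ψ (x + z)) * kk p z := by
    rw [← integral_integral_swap
      (f := fun x z => (W x - W (x + z)) * (ψ x - ψ (x + z)) * kk p z) hH2]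
    rw [Measure.volume_eq_prod, integral_prod _ hH]
    congr 1; ext x
    rw [← integral_add_left_eq_self _ x]
    simp [kk_neg]
  rw [e1, e2]
  congr 1; ext z
  have hcs : HasCompactSupport ψ :=
    HasCompactSupport.intro (isCompact_closedBall (0 : EE d) 1) fun x hx => hψ.supp x fun h => 
      hx (ball_subset_closedBall h)
  have i1 : Integrable (fun x => ψ x * (W x - W (x + z))) :=
    Continuous.integrable_of_hasCompactSupport (by fun_prop) hcs.mul_right
  have i2 : Integrable (fun x => ψ x * (W x - W (x - z))) :=
    Continuous.integrable_of_hasCompactSupport (by fun_prop) hcs.mul_right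
  have i3 := i2.comp_add_right z
  have e3 : ∫ x, ψ x * (W x - W (x - z)) = ∫ x, ψ (x + z) * (W (x + z) - W (x + z - z)) :=
    (integral_add_right_eq_self (fun x => ψ x * (W x - W (x - z))) z).symm
  simp_rw [← mul_assoc]
  rw [integral_mul_const, integral_mul_const]
  congr 1
  calc ∫ x, ψ x * (2 * W x - W (x + z) - W (x - z))
      = ∫ x, (ψ x * (W x - W (x + z)) + ψ x * (W x - W (x - z))) := by congr 1; ext x; ring
    _ = (∫ x, ψ x * (W x - W (x + z))) + ∫ x, ψ (x + z) * (W (x + z) - W (x + z - z)) := by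
        rw [integral_add i1 i2, e3]
    _ = _ := by
        rw [← integral_add i1 i3]; congr 1; ext x
        rw [add_sub_cancel_right]; ring


lemma moll {d : ℕ} {η : EE d → ℝ} {L : ℝ} (hη : LipC η L)
    (h34 : ∀ x, x ∉ ball (0 : EE d) (3/4) → η x = 0) :
    ∃ e : ℕ → EE d → ℝ, (∀ n, ContDiff ℝ (⊤ : ℕ∞) (e n)) ∧ (∀ n, LipC (e n) L) ∧
      ∀ x, Filter.Tendsto (fun n => e n x) Filter.atTop (𝓝 (η x)) := by
  let φ : ℕ → ContDiffBump (0 : EE d) := fun n =>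
    ⟨1 / (2 * ((n:ℝ) + 5)), 1 / ((n:ℝ) + 5), by positivity, by
      apply one_div_lt_one_div_of_lt <;> linarith [(Nat.cast_nonneg n : (0:ℝ) ≤ n)]⟩
  have hr : ∀ n, (φ n).rOut = 1 / ((n:ℝ) + 5) := fun n => rfl
  have hr4 : ∀ n, (φ n).rOut ≤ 1 / 4 := fun n => by
    rw [hr]; apply one_div_le_one_div_of_le <;> linarith [(Nat.cast_nonneg n : (0:ℝ) ≤ n)]
  have hc := hη.cont
  have hint : ∀ n, Integrable ((φ n).normed volume : EE d → ℝ) := fun n => (φ n).integrable_normed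
  have hint2 : ∀ n x, Integrable (fun t => (φ n).normed volume t * η (x - t)) := fun n x => by
    refine Continuous.integrable_of_hasCompactSupport ?_ ((φ n).hasCompactSupport_normed.mul_right)
    exact (φ n).continuous_normed.mul (by fun_prop)
  have hval : ∀ n x, ((φ n).normed volume ⋆[ContinuousLinearMap.lsmul ℝ ℝ, volume] η) x
      = ∫ t, (φ n).normed volume t * η (x - t) := fun n x => rfl
  have hone : ∀ n (c : ℝ), ∫ t, (φ n).normed (volume : Measure (EE d)) t * c = c := fun n c => by
    rw [integral_mul_const, (φ n).integral_normed, one_mul]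
  refine ⟨fun n => (φ n).normed volume ⋆[ContinuousLinearMap.lsmul ℝ ℝ, volume] η, ?_, ?_, ?_⟩
  · intro n
    exact HasCompactSupport.contDiff_convolution_left _ (φ n).hasCompactSupport_normed
      (φ n).contDiff_normed (hc.locallyIntegrable)
  · intro n
    refine ⟨?_, ?_, ?_⟩
    · intro x hx
      beta_reduce
      rw [hval]
      rw [← integral_zero (EE d) ℝ]
      congr 1; ext t
      by_cases ht : t ∈ ball (0 : EE d) (φ n).rOut
      · rw [h34, mul_zero]
        intro hxt
        apply hx
        rw [mem_ball_zero_iff] at *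
        have := norm_le_norm_add_norm_sub t x
        have := norm_sub_rev x t
        have := hr4 n
        linarith
      · have : t ∉ Function.support ((φ n).normed (volume : Measure (EE d))) := by
          rw [(φ n).support_normed_eq]; exact ht
        rw [Function.notMem_support.1 this, zero_mul]
    · intro x y
      beta_reduce
      rw [hval, hval, ← integral_sub (hint2 n x) (hint2 n y)]
      rw [← hone n (L * ‖x - y‖), ← Real.norm_eq_abs]
      refine norm_integral_le_of_norm_le ((hint n).mul_const _) (Filter.Eventually.of_forall fun t => ?_)
      rw [← mul_sub, norm_mul, Real.norm_of_nonneg ((φ n).nonneg_normed t)]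
      refine mul_le_mul_of_nonneg_left ?_ ((φ n).nonneg_normed t)
      have := hη.lip (x - t) (y - t)
      rwa [sub_sub_sub_cancel_right] at this
    · intro x
      beta_reduce
      rw [hval]
      conv_rhs => rw [← hone n L]
      rw [← Real.norm_eq_abs]
      refine norm_integral_le_of_norm_le ((hint n).mul_const _) (Filter.Eventually.of_forall fun t => ?_)
      rw [norm_mul, Real.norm_of_nonneg ((φ n).nonneg_normed t)]
      exact mul_le_mul_of_nonneg_left (hη.bdd _) ((φ n).nonneg_normed t)
  · intro x
    refine ContDiffBump.convolution_tendsto_right_of_continuous ?_ hc x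
    simp only [hr]
    exact Filter.Tendsto.div_atTop tendsto_const_nhds
      (Filter.tendsto_atTop_add_const_right _ _ tendsto_natCast_atTop_atTop)

lemma LocL.of_LipC {d : ℕ} {ψ : EE d → ℝ} {L : ℝ} (h : LipC ψ L) : LocL ψ L :=
  ⟨h.cont, h.bdd, fun x _ y _ => h.lip x y⟩

lemma stab {d : ℕ} (hd : 1 ≤ d) {s : ℝ} (hs0 : 0 < s) (hs1 : s < 1) {g : EE d → ℝ}
    (hg : Continuous g) (c : ℝ)
    (hst : ∀ η : EE d → ℝ, ContDiff ℝ (⊤ : ℕ∞) η → HasCompactSupport η →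
      ∫ x, g x * (η x)^2 ≤ c * ∫ x, ∫ y, (η x - η y)^2 / ‖x - y‖ ^ ((d : ℝ) + 2*s))
    {η : EE d → ℝ} {L : ℝ} (hη : LipC η L)
    (h34 : ∀ x, x ∉ ball (0 : EE d) (3/4) → η x = 0) :
    ∫ x, g x * (η x)^2 ≤ c * ∫ q : EE d × EE d, (η q.1 - η q.2)^2 * kk ((d : ℝ) + 2*s) (q.1 - q.2) := by
  obtain ⟨e, he1, he2, he3⟩ := moll hη h34
  set p := (d : ℝ) + 2*s with hp
  have c3 := kk_meas (d := d) p
  have hL := hη.nonneg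
  have key : ∀ n, ∫ x, g x * (e n x)^2 ≤
      c * ∫ q : EE d × EE d, (e n q.1 - e n q.2)^2 * kk p (q.1 - q.2) := by
    intro n
    refine (hst (e n) (he1 n) ?_).trans (le_of_eq ?_)
    · exact HasCompactSupport.intro (isCompact_closedBall (0 : EE d) 1) fun x hx => (he2 n).supp x fun h => 
        hx (ball_subset_closedBall h)
    · congr 1
      have hi := bil_integrable hd hs0 hs1 (LocL.of_LipC (he2 n)) (he2 n)
      have hi2 : Integrable (fun q : EE d × EE d => (e n q.1 - e n q.2)^2 * kk p (q.1 - q.2)) := by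
        refine hi.congr (Filter.Eventually.of_forall fun q => ?_)
        simp only [pow_two]; rfl
      rw [Measure.volume_eq_prod, integral_prod _ hi2]
      rfl
  refine le_of_tendsto_of_tendsto' (b := Filter.atTop) ?_ ?_ key
  · obtain ⟨G, hG⟩ := (isCompact_closedBall (0 : EE d) 1).exists_bound_of_continuousOn hg.continuousOn
    have hG0 : 0 ≤ G := (norm_nonneg _).trans (hG 0 (by simp))
    refine tendsto_integral_of_dominated_convergence (fun x => G * L ^ 2 * ind x) ?_
      (ind_integrable.const_mul _) ?_ ?_
    · intro n
      have := (he2 n).cont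
      exact (by fun_prop : Continuous _).aestronglyMeasurable
    · intro n
      refine Filter.Eventually.of_forall fun x => ?_
      by_cases hx : x ∈ ball (0 : EE d) 1
      · rw [ind_eq_one hx, norm_mul, norm_pow, mul_one]
        have h1 := hG x (ball_subset_closedBall hx)
        have h2 := (he2 n).bdd x
        rw [Real.norm_eq_abs (e n x)]
        gcongr
      · rw [(he2 n).supp x hx]; have := ind_nonneg x
        simp; positivity
    · exact Filter.Eventually.of_forall fun x => ((he3 x).pow 2).const_mul _
  · refine Filter.Tendsto.const_mul _ ?_
    refine tendsto_integral_of_dominated_convergence (fun q => 4 * L ^ 2 * dom p q) ?_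
      ((dom_integrable hd hs0 hs1).const_mul _) ?_ ?_
    · intro n
      have := (he2 n).cont
      exact Measurable.aestronglyMeasurable (by fun_prop)
    · intro n
      refine Filter.Eventually.of_forall fun q => ?_
      refine le_dom (by positivity) ?_ ?_
      · intro h
        rw [← min_sq, abs_pow]
        have h1 := (he2 n).diff_le q.1 q.2
        calc _ ≤ (2 * L * min 1 ‖q.1 - q.2‖) ^ 2 := by gcongr
          _ = _ := by ring
      · intro h
        simp [(he2 n).zero h]
    · exact Filter.Eventually.of_forall fun q => (((he3 q.1).sub (he3 q.2)).pow 2).mul_const _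


/-- cutoff -/
noncomputable def cut {d : ℕ} (x : EE d) : ℝ := max 0 (min 1 (3 - 4 * ‖x‖))

lemma cut_nonneg {d : ℕ} (x : EE d) : 0 ≤ cut x := le_max_left _ _
lemma cut_le_one {d : ℕ} (x : EE d) : cut x ≤ 1 := max_le zero_le_one (min_le_left _ _)
lemma cut_one {d : ℕ} {x : EE d} (h : x ∈ ball (0 : EE d) (1/2)) : cut x = 1 := by
  have : ‖x‖ < 1/2 := by simpa using h
  unfold cut
  rw [min_eq_left (by linarith), max_eq_right zero_le_one]
lemma cut_zero {d : ℕ} {x : EE d} (h : x ∉ ball (0 : EE d) (3/4)) : cut x = 0 := by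
  have : 3/4 ≤ ‖x‖ := by simpa using h
  unfold cut
  exact max_eq_left ((min_le_right _ _).trans (by linarith))

lemma cut_lip {d : ℕ} : LipC (cut : EE d → ℝ) 4 := by
  refine ⟨fun x hx => cut_zero fun h => hx (ball_subset_ball (by norm_num) h), ?_, ?_⟩
  · intro x y
    unfold cut
    have h1 := abs_norm_sub_norm_le x y
    calc _ ≤ |min 1 (3 - 4 * ‖x‖) - min 1 (3 - 4 * ‖y‖)| := by
          rw [max_comm 0, max_comm 0]; exact abs_max_sub_max_le_abs _ _ _
      _ ≤ |(3 - 4 * ‖x‖) - (3 - 4 * ‖y‖)| := by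
          rw [min_comm 1, min_comm 1]
          exact abs_inf_sub_inf_le_abs _ _ _
      _ = 4 * |‖x‖ - ‖y‖| := by
          rw [← abs_neg, show -((3 - 4 * ‖x‖) - (3 - 4 * ‖y‖)) = 4 * (‖x‖ - ‖y‖) by ring, abs_mul]; simp
      _ ≤ _ := by linarith
  · intro x
    rw [abs_of_nonneg (cut_nonneg x)]; linarith [cut_le_one x]

lemma LipC.mul {d : ℕ} {φ V : EE d → ℝ} {L A : ℝ} (hφ : LipC φ L) (hV : LocL V A) :
    LipC (fun x => φ x * V x) (2 * L * A) := by
  have hL := hφ.nonneg; have hA := hV.nonneg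
  have hb : ∀ x, |φ x * V x| ≤ L * A := fun x => by
    rw [abs_mul]; exact mul_le_mul (hφ.bdd x) (hV.bdd x) (abs_nonneg _) hL
  have hLA := mul_nonneg hL hA
  have far : ∀ x y : EE d, y ∉ ball (0 : EE d) 2 → |φ x * V x - φ y * V y| ≤ 2 * L * A * ‖x - y‖ := by
    intro x y hy
    have hy' : 2 ≤ ‖y‖ := by simpa using hy
    rw [hφ.supp y (by simp; linarith), zero_mul, sub_zero]
    by_cases hx : x ∈ ball (0 : EE d) 1
    · have hx' : ‖x‖ < 1 := by simpa using hx
      have := norm_le_norm_add_norm_sub x y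
      have h1 : 1 ≤ ‖x - y‖ := by linarith
      nlinarith [hb x]
    · rw [hφ.supp x hx]; simp; positivity
  refine ⟨fun x hx => by rw [hφ.supp x hx, zero_mul], fun x y => ?_, fun x => (hb x).trans (by linarith)⟩
  by_cases hy : y ∈ ball (0 : EE d) 2
  · by_cases hx : x ∈ ball (0 : EE d) 2
    · have e : φ x * V x - φ y * V y = φ x * (V x - V y) + V y * (φ x - φ y) := by ring
      rw [e]
      refine (abs_add_le _ _).trans ?_
      rw [abs_mul, abs_mul]
      have h1 := mul_le_mul (hφ.bdd x) (hV.lip x hx y hy) (abs_nonneg _) hL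
      have h2 := mul_le_mul (hV.bdd y) (hφ.lip x y) (abs_nonneg _) hA
      linarith
    · have := far y x hx
      rwa [abs_sub_comm, norm_sub_rev]
  · exact far x y hy

lemma LocL.abs {d : ℕ} {V : EE d → ℝ} {A : ℝ} (hV : LocL V A) : LocL (fun x => |V x|) A :=
  ⟨hV.cont.abs, fun x => by simpa using hV.bdd x,
    fun x hx y hy => (abs_abs_sub_abs_le _ _).trans (hV.lip x hx y hy)⟩

lemma LocL.sub {d : ℕ} {V W : EE d → ℝ} {A B : ℝ} (hV : LocL V A) (hW : LocL W B) :
    LocL (fun x => V x - W x) (A + B) := by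
  refine ⟨hV.cont.sub hW.cont, fun x => (abs_sub _ _).trans (add_le_add (hV.bdd x) (hW.bdd x)),
    fun x hx y hy => ?_⟩
  rw [show V x - W x - (V y - W y) = (V x - V y) - (W x - W y) by ring]
  refine (abs_sub _ _).trans ?_
  have := hV.lip x hx y hy; have := hW.lip x hx y hy
  linarith

lemma N_integrable {d : ℕ} (hd : 1 ≤ d) {s : ℝ} (hs0 : 0 < s) (hs1 : s < 1)
    {D : EE d × EE d → ℝ} (hD : Continuous D) {A : ℝ} (hA : ∀ q, |D q| ≤ A) :
    Integrable (fun q : EE d × EE d => D q * ((cut q.1 - cut q.2)^2 * kk ((d:ℝ) + 2 * s) (q.1 - q.2))) := by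
  have h := bil_integrable hd hs0 hs1 (LocL.of_LipC (cut_lip (d := d))) cut_lip
  refine (h.bdd_mul (c := A) hD.aestronglyMeasurable (Filter.Eventually.of_forall hA)).congr
    (Filter.Eventually.of_forall fun q => ?_)
  simp only [pow_two]

lemma comb {d : ℕ} (hd : 1 ≤ d) {s : ℝ} (hs0 : 0 < s) (hs1 : s < 1) {c : ℝ} (hc : 0 < c)
    {u v F F' g : EE d → ℝ} {A B : ℝ} (hu : LocL u A) (hv : LocL v B)
    (hu2 : ContDiff ℝ 2 u) (hv2 : ContDiff ℝ 2 v) (hF : Continuous F) (hF' : Continuous F')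
    (hg : Continuous g)
    (equ : ∀ x, c * ∫ z, (2 * u x - u (x + z) - u (x - z)) / ‖z‖ ^ ((d:ℝ) + 2 * s) = F x)
    (eqv : ∀ x, c * ∫ z, (2 * v x - v (x + z) - v (x - z)) / ‖z‖ ^ ((d:ℝ) + 2 * s) = F' x)
    (hst : ∀ η : EE d → ℝ, ContDiff ℝ (⊤ : ℕ∞) η → HasCompactSupport η →
      ∫ x, g x * (η x)^2 ≤ c * ∫ x, ∫ y, (η x - η y)^2 / ‖x - y‖ ^ ((d : ℝ) + 2*s))
    {U : EE d → ℝ} (hU : ∀ x, U x = v x - u x) :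
    Integrable (fun q : EE d × EE d => cut q.1 * cut q.2 * (|U q.1| * |U q.2| - U q.1 * U q.2) *
      kk ((d:ℝ) + 2 * s) (q.1 - q.2)) ∧
    2 * ∫ q : EE d × EE d, cut q.1 * cut q.2 * (|U q.1| * |U q.2| - U q.1 * U q.2) *
      kk ((d:ℝ) + 2 * s) (q.1 - q.2) ≤
    (∫ q : EE d × EE d, (U q.1 * U q.2) * 
      ((cut q.1 - cut q.2)^2 * kk ((d:ℝ) + 2 * s) (q.1 - q.2))) +
    c⁻¹ * ∫ x, cut x ^ 2 * U x * (F' x - F x - g x * U x) := by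
  set p := (d:ℝ) + 2 * s with hp
  have hUL : LocL U (B + A) := by
    have := hv.sub hu
    rwa [← (funext hU : U = fun x => v x - u x)] at this
  have hη := cut_lip.mul hUL.abs
  have hψ1 := cut_lip.mul hUL
  have hψ := cut_lip.mul (LocL.of_LipC hψ1)
  have hUc := hUL.cont
  have hcc := (cut_lip (d := d)).cont
  -- weak forms
  have wu := weak_form hd hs0 hs1 hu hu2 hψ
  have wv := weak_form hd hs0 hs1 hv hv2 hψ
  have bu := bil_integrable hd hs0 hs1 hu hψ
  have bv := bil_integrable hd hs0 hs1 hv hψ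
  have bU := bil_integrable hd hs0 hs1 hUL hψ
  have bη := bil_integrable hd hs0 hs1 (LocL.of_LipC hη) hη
  have iN := N_integrable hd hs0 hs1 (D := fun q : EE d × EE d => U q.1 * U q.2) (by fun_prop)
    (A := (B + A) * (B + A)) (fun q => by
      rw [abs_mul]; exact mul_le_mul (hUL.bdd _) (hUL.bdd _) (abs_nonneg _) hUL.nonneg)
  rw [← hp] at wu wv bu bv bU bη iN
  have st := stab hd hs0 hs1 hg c hst hη (fun x hx => by rw [cut_zero hx, zero_mul])
  rw [← hp] at st
  have hcs : ∀ (G : EE d → ℝ), Continuous G → Integrable (fun x => cut x * G x) := fun G hG =>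
    Continuous.integrable_of_hasCompactSupport (by fun_prop) (HasCompactSupport.mul_right
     (HasCompactSupport.intro (isCompact_closedBall (0 : EE d) 1) fun x hx => cut_lip.supp x fun h => 
      hx (ball_subset_closedBall h)))
  have w1 : ∫ x, (cut x * (cut x * U x)) * (F' x - F x) = 
      c * ∫ q : EE d × EE d, (U q.1 - U q.2) *
        (cut q.1 * (cut q.1 * U q.1) - cut q.2 * (cut q.2 * U q.2)) * kk p (q.1 - q.2) := by
    have e : ∀ q : EE d × EE d, (U q.1 - U q.2) *
        (cut q.1 * (cut q.1 * U q.1) - cut q.2 * (cut q.2 * U q.2)) * kk p (q.1 - q.2) = 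
        (v q.1 - v q.2) *
        (cut q.1 * (cut q.1 * U q.1) - cut q.2 * (cut q.2 * U q.2)) * kk p (q.1 - q.2)
        - (u q.1 - u q.2) *
        (cut q.1 * (cut q.1 * U q.1) - cut q.2 * (cut q.2 * U q.2)) * kk p (q.1 - q.2) := by
      intro q; rw [hU q.1, hU q.2]; ring
    rw [integral_congr_ae (Filter.Eventually.of_forall e), integral_sub bv bu, ← wu, ← wv, mul_sub,
      ← integral_const_mul, ← integral_const_mul, ← integral_sub]
    · congr 1; ext x; rw [← equ, ← eqv]; ring
    · refine (hcs (fun x => (cut x * U x) * F' x) (by fun_prop)).congr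
        (Filter.Eventually.of_forall fun x => ?_)
      simp only; rw [← eqv]; ring
    · refine (hcs (fun x => (cut x * U x) * F x) (by fun_prop)).congr
        (Filter.Eventually.of_forall fun x => ?_)
      simp only; rw [← equ]; ring
  have pt : ∀ q : EE d × EE d, 2 * (cut q.1 * cut q.2 * (|U q.1| * |U q.2| - U q.1 * U q.2) *
      kk p (q.1 - q.2)) = (U q.1 * U q.2) * ((cut q.1 - cut q.2)^2 * kk p (q.1 - q.2)) 
      - ((cut q.1 * |U q.1| - cut q.2 * |U q.2|) * (cut q.1 * |U q.1| - cut q.2 * |U q.2|) * kk p (q.1 - q.2)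
       - (U q.1 - U q.2) *
        (cut q.1 * (cut q.1 * U q.1) - cut q.2 * (cut q.2 * U q.2)) * kk p (q.1 - q.2)) := by
    intro q
    have h1 := abs_mul_abs_self (U q.1)
    have h2 := abs_mul_abs_self (U q.2)
    linear_combination (cut q.1 ^ 2 * kk p (q.1 - q.2)) * h1 + (cut q.2 ^ 2 * kk p (q.1 - q.2)) * h2
  have iP2 := iN.sub (bη.sub bU)
  have iP : Integrable (fun q : EE d × EE d => 2 * (cut q.1 * cut q.2 * (|U q.1| * |U q.2| - U q.1 * U q.2) *
      kk p (q.1 - q.2))) := iP2.congr (Filter.Eventually.of_forall fun q => (pt q).symm)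
  refine ⟨?_, ?_⟩
  · refine (iP.const_mul (1/2)).congr (Filter.Eventually.of_forall fun q => ?_)
    simp only; ring
  · have e0 := integral_sub iN (bη.sub bU)
    simp only [Pi.sub_apply] at e0
    rw [← integral_const_mul, integral_congr_ae (Filter.Eventually.of_forall pt), 
      e0, integral_sub bη bU]
    have e2 : ∫ q : EE d × EE d, (cut q.1 * |U q.1| - cut q.2 * |U q.2|) ^ 2 * kk p (q.1 - q.2) = 
      ∫ q : EE d × EE d, (cut q.1 * |U q.1| - cut q.2 * |U q.2|) * (cut q.1 * |U q.1| - cut q.2 * |U q.2|)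
        * kk p (q.1 - q.2) := by simp only [pow_two]
    rw [e2] at st
    have e3 : ∫ x, cut x ^ 2 * U x * (F' x - F x - g x * U x) = 
        (∫ x, (cut x * (cut x * U x)) * (F' x - F x)) - ∫ x, g x * (cut x * |U x|) ^ 2 := by
      rw [← integral_sub]
      · congr 1; ext x; rw [mul_pow, sq_abs]; ring
      · refine (hcs (fun x => (cut x * U x) * (F' x - F x)) (by fun_prop)).congr
          (Filter.Eventually.of_forall fun x => ?_)
        simp only; ring
      · refine (hcs (fun x => g x * (cut x * |U x| ^ 2)) (by fun_prop)).congr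
          (Filter.Eventually.of_forall fun x => ?_)
        simp only; ring
    rw [e3, w1]
    set X := ∫ q : EE d × EE d, (cut q.1 * |U q.1| - cut q.2 * |U q.2|) * (cut q.1 * |U q.1| - cut q.2 * |U q.2|)
        * kk p (q.1 - q.2)
    set Y := ∫ x, g x * (cut x * |U x|) ^ 2
    have h5 : c⁻¹ * Y ≤ X := by
      rw [inv_mul_le_iff₀ hc]; exact st
    rw [mul_sub, ← mul_assoc, inv_mul_cancel₀ hc.ne']
    linarith


/-- cut kernel -/
noncomputable def GG {d : ℕ} (p : ℝ) (x y : EE d) : ℝ := (cut x - cut y) ^ 2 * kk p (x - y)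

/-- mixed second difference of `GG` -/
noncomputable def TT {d : ℕ} (p : ℝ) (h x y : EE d) : ℝ :=
  GG p x y + GG p (x - h) (y - h) - GG p (x - h) y - GG p x (y - h)

lemma GG_nonneg {d : ℕ} (p : ℝ) (x y : EE d) : 0 ≤ GG p x y :=
  mul_nonneg (sq_nonneg _) (kk_nonneg _ _)

lemma GG_le {d : ℕ} (p : ℝ) (x y : EE d) : GG p x y ≤ 64 * kap p (x - y) := by
  unfold GG kap
  rw [← mul_assoc]
  refine mul_le_mul_of_nonneg_right ?_ (kk_nonneg _ _)
  have := cut_lip.diff_le x y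
  rw [← min_sq, ← sq_abs]
  calc _ ≤ (2 * 4 * min 1 ‖x - y‖) ^ 2 := by gcongr
    _ = _ := by ring

lemma TT_far {d : ℕ} (p : ℝ) : ∃ C : ℝ, 0 ≤ C ∧ ∀ h x y : EE d, x ≠ y → 4 * ‖h‖ ≤ ‖x - y‖ →
    |TT p h x y| ≤ C * ‖h‖ ^ 2 * kk p (x - y) := by
  obtain ⟨C, hC0, hC⟩ := kk_diff (d := d) p
  refine ⟨32 + 105 * C, by positivity, fun h x y hxy hh => ?_⟩
  obtain ⟨h1, h2⟩ := hC (x - y) h (sub_ne_zero.2 hxy) hh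
  have hz : 0 < ‖x - y‖ := norm_pos_iff.2 (sub_ne_zero.2 hxy)
  unfold TT GG
  rw [show x - h - (y - h) = x - y by abel, show x - h - y = x - y - h by abel,
    show x - (y - h) = x - y + h by abel]
  have hk := kk_nonneg p (x - y)
  have l1 := cut_lip.lip x (x - h)
  have l2 := cut_lip.lip y (y - h)
  have l3 := cut_lip.lip (x - h) y
  have l4 := cut_lip.lip x (y - h)
  rw [sub_sub_cancel] at l1 l2
  rw [show x - h - y = (x - y) - h by abel] at l3
  rw [show x - (y - h) = (x - y) + h by abel] at l4
  have n3 := norm_sub_le (x - y) h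
  have n4 := norm_add_le (x - y) h
  set k := kk p (x - y)
  set kp := kk p (x - y + h)
  set km := kk p (x - y - h)
  set a := cut x
  set b := cut y
  set a' := cut (x - h)
  set b' := cut (y - h)
  set Z := ‖x - y‖
  set H := ‖h‖ with hH
  have hH0 : 0 ≤ H := norm_nonneg h
  have e : (a - b) ^ 2 * k + (a' - b') ^ 2 * k - (a' - b) ^ 2 * km - (a - b') ^ 2 * kp
     = (-2 * (a - a') * (b - b')) * k + (a' - b) ^ 2 * (2 * k - kp - km) +
       (((a - a') + (b - b')) * ((a - b') + (a' - b))) * (k - kp) := by ring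
  rw [e]
  refine (abs_add_three _ _ _).trans ?_
  have t1 : |(-2 * (a - a') * (b - b')) * k| ≤ 32 * H ^ 2 * k := by
    rw [abs_mul, abs_mul, abs_mul, abs_of_nonneg hk]
    refine mul_le_mul_of_nonneg_right ?_ hk
    have := mul_le_mul l1 l2 (abs_nonneg _) (by positivity)
    norm_num
    nlinarith
  have t2 : |(a' - b) ^ 2 * (2 * k - kp - km)| ≤ 25 * C * H ^ 2 * k := by
    rw [abs_mul, abs_pow]
    have q1 : |a' - b| ≤ 5 * Z := by linarith
    have q2 : |a' - b| ^ 2 ≤ (5 * Z) ^ 2 := by gcongr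
    calc |a' - b| ^ 2 * |2 * k - kp - km| ≤ (5 * Z) ^ 2 * (C * (H / Z) ^ 2 * k) :=
          mul_le_mul q2 h2 (abs_nonneg _) (by positivity)
      _ = 25 * C * H ^ 2 * k := by field_simp; ring
  have t3 : |(((a - a') + (b - b')) * ((a - b') + (a' - b))) * (k - kp)| ≤ 80 * C * H ^ 2 * k := by
    rw [abs_mul, abs_mul]
    have q1 : |(a - a') + (b - b')| ≤ 8 * H := (abs_add_le _ _).trans (by linarith)
    have q2 : |(a - b') + (a' - b)| ≤ 10 * Z := (abs_add_le _ _).trans (by linarith)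
    calc _ ≤ (8 * H) * (10 * Z) * (C * (H / Z) * k) :=
          mul_le_mul (mul_le_mul q1 q2 (abs_nonneg _) (by positivity)) h1 (abs_nonneg _) (by positivity)
      _ = 80 * C * H ^ 2 * k := by field_simp; ring
  linarith

lemma TT_zero {d : ℕ} (p : ℝ) {h x y : EE d} (hh : ‖h‖ ≤ 1/4) (hx : x ∉ ball (0 : EE d) 1)
    (hy : y ∉ ball (0 : EE d) 1) : TT p h x y = 0 := by
  have aux : ∀ w : EE d, w ∉ ball (0 : EE d) 1 → cut w = 0 ∧ cut (w - h) = 0 := by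
    intro w hw
    have hw' : 1 ≤ ‖w‖ := by simpa using hw
    have := norm_sub_norm_le w h
    exact ⟨cut_lip.supp w hw, cut_zero (by simp; linarith)⟩
  simp [TT, GG, aux x hx, aux y hy]

/-- near-diagonal kernel -/
noncomputable def lam {d : ℕ} (p r : ℝ) (z : EE d) : ℝ := (ball (0 : EE d) (5 * r)).indicator (kap p) z

lemma lam_nonneg {d : ℕ} (p r : ℝ) (z : EE d) : 0 ≤ lam p r z :=
  indicator_nonneg (fun _ _ => kap_nonneg _ _) _

lemma lam_integrable {d : ℕ} (hd : 1 ≤ d) {s : ℝ} (hs0 : 0 < s) (hs1 : s < 1) (r : ℝ) :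
    Integrable (lam ((d : ℝ) + 2 * s) r : EE d → ℝ) :=
  (kap_integrable hd hs0 hs1).indicator measurableSet_ball

lemma lam_tendsto {d : ℕ} (hd : 1 ≤ d) {s : ℝ} (hs0 : 0 < s) (hs1 : s < 1) {r : ℕ → ℝ} 
    (hr : Filter.Tendsto r Filter.atTop (𝓝 0)) :
    Filter.Tendsto (fun n => ∫ z : EE d, lam ((d : ℝ) + 2 * s) (r n) z) Filter.atTop (𝓝 0) := by
  rw [← integral_zero (EE d) ℝ]
  refine tendsto_integral_of_dominated_convergence (kap ((d : ℝ) + 2 * s)) ?_ 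
    (kap_integrable hd hs0 hs1) ?_ ?_
  · exact fun n => (lam_integrable hd hs0 hs1 _).aestronglyMeasurable
  · intro n
    refine Filter.Eventually.of_forall fun z => ?_
    rw [Real.norm_of_nonneg (lam_nonneg _ _ _)]
    exact indicator_le_self' (fun _ _ => kap_nonneg _ _) z
  · refine Filter.Eventually.of_forall fun z => ?_
    by_cases hz : z = 0
    · have : ∀ n, lam ((d : ℝ) + 2 * s) (r n) z = 0 := by
        intro n; subst hz; simp [lam, kap, indicator]
      simp [this]
    · have hz' : 0 < ‖z‖ / 5 := by have := norm_pos_iff.2 hz; positivity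
      refine tendsto_const_nhds.congr' ?_
      filter_upwards [hr.eventually (gt_mem_nhds hz')] with n hn
      unfold lam
      rw [indicator_of_notMem]
      simp; linarith

lemma integral_prod_sub_eq {d : ℕ} {a b : EE d → ℝ} (ha : Integrable a) (hb : Integrable b) :
    ∫ q : EE d × EE d, a q.1 * b (q.1 - q.2) = (∫ x, a x) * ∫ z, b z := by
  rw [Measure.volume_eq_prod, integral_prod _ (integrable_prod_sub' ha hb), ← integral_mul_const]
  congr 1; ext x
  simp only
  rw [integral_const_mul, integral_sub_left_eq_self b volume x]

/-- indicator of ball of radius 2 -/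
noncomputable def ind2 {d : ℕ} (x : EE d) : ℝ := (ball (0 : EE d) 2).indicator (fun _ => (1:ℝ)) x

lemma ind2_nonneg {d : ℕ} (x : EE d) : 0 ≤ ind2 x := indicator_nonneg (by simp) _
lemma ind2_integrable {d : ℕ} : Integrable (ind2 : EE d → ℝ) := by
  unfold ind2
  exact (integrable_indicator_iff measurableSet_ball).2 (by simp [integrableOn_const_iff, measure_ball_lt_top])

lemma lamsum_integrable {d : ℕ} (hd : 1 ≤ d) {s : ℝ} (hs0 : 0 < s) (hs1 : s < 1) (h : EE d) :
    Integrable (fun z => 2 * lam ((d:ℝ) + 2 * s) ‖h‖ z + lam ((d:ℝ) + 2 * s) ‖h‖ (z - h) +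
      lam ((d:ℝ) + 2 * s) ‖h‖ (z + h)) ∧
    ∫ z, (2 * lam ((d:ℝ) + 2 * s) ‖h‖ z + lam ((d:ℝ) + 2 * s) ‖h‖ (z - h) +
      lam ((d:ℝ) + 2 * s) ‖h‖ (z + h)) = 4 * ∫ z : EE d, lam ((d:ℝ) + 2 * s) ‖h‖ z := by
  have hl := lam_integrable hd hs0 hs1 ‖h‖
  have h1 := hl.const_mul 2
  have h2 := hl.comp_sub_right h
  have h3 := hl.comp_add_right h
  have h12 : Integrable (fun z => 2 * lam ((d:ℝ) + 2 * s) ‖h‖ z + lam ((d:ℝ) + 2 * s) ‖h‖ (z - h)) :=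
    h1.add h2
  refine ⟨h12.add h3, ?_⟩
  rw [integral_add h12 h3, integral_add h1 h2, integral_const_mul,
    integral_sub_right_eq_self (lam ((d:ℝ) + 2 * s) ‖h‖) h,
    integral_add_right_eq_self (lam ((d:ℝ) + 2 * s) ‖h‖) h]
  ring

lemma TT_near {d : ℕ} (p : ℝ) {h x y : EE d} (hh : ‖h‖ ≤ 1/4) (hxy : ‖x - y‖ < 4 * ‖h‖) :
    |TT p h x y| ≤ 64 * (ind2 x * 
      (2 * lam p ‖h‖ (x - y) + lam p ‖h‖ (x - y - h) + lam p ‖h‖ (x - y + h))) := by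
  by_cases hx : x ∉ ball (0 : EE d) 2
  · have hx' : 2 ≤ ‖x‖ := by simpa using hx
    have := norm_le_norm_add_norm_sub y x
    rw [norm_sub_rev] at this
    rw [TT_zero p hh (by simp; linarith) (by simp; linarith [norm_sub_rev x y])]
    have := ind2_nonneg x
    have := lam_nonneg p ‖h‖ (x - y)
    have := lam_nonneg p ‖h‖ (x - y - h)
    have := lam_nonneg p ‖h‖ (x - y + h)
    simp only [abs_zero]; positivity
  · rw [not_not] at hx
    have e1 : ind2 x = 1 := by simp only [ind2]; rw [indicator_of_mem hx]
    have hl : ∀ z : EE d, ‖z‖ < 5 * ‖h‖ → lam p ‖h‖ z = kap p z := fun z hz => by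
      unfold lam; rw [indicator_of_mem (by simpa using hz)]
    have n1 := norm_sub_le (x - y) h
    have n2 := norm_add_le (x - y) h
    have hn := norm_nonneg h
    have g1 := GG_le p x y
    have g2 := GG_le p (x - h) (y - h)
    have g3 := GG_le p (x - h) y
    have g4 := GG_le p x (y - h)
    have p1 := GG_nonneg p x y
    have p2 := GG_nonneg p (x - h) (y - h)
    have p3 := GG_nonneg p (x - h) y
    have p4 := GG_nonneg p x (y - h)
    rw [show x - h - (y - h) = x - y by abel] at g2
    rw [show x - h - y = x - y - h by abel] at g3
    rw [show x - (y - h) = x - y + h by abel] at g4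
    rw [e1, hl _ (by linarith [norm_nonneg (x - y)]), hl _ (by linarith), hl _ (by linarith)]
    unfold TT
    rw [abs_le]
    constructor <;> linarith


/-- the index set of the energy -/
def OmS (d : ℕ) : Set (EE d × EE d) := ((ball (0 : EE d) 1)ᶜ ×ˢ (ball (0 : EE d) 1)ᶜ)ᶜ

lemma OmS_meas (d : ℕ) : MeasurableSet (OmS d) :=
  (measurableSet_ball.compl.prod measurableSet_ball.compl).compl

lemma Js_int {d : ℕ} {s : ℝ} {u : EE d → ℝ} (hu : Continuous u)
    (hJ : Js d s u (ball (0 : EE d) 1) ≠ ⊤) :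
    Integrable ((OmS d).indicator fun q : EE d × EE d => 
      (u q.1 - u q.2) ^ 2 * kk ((d:ℝ) + 2 * s) (q.1 - q.2)) ∧
    ∫ q, (OmS d).indicator (fun q : EE d × EE d => 
      (u q.1 - u q.2) ^ 2 * kk ((d:ℝ) + 2 * s) (q.1 - q.2)) q = (Js d s u (ball (0 : EE d) 1)).toReal := by
  have hk := kk_meas (d := d) ((d:ℝ) + 2 * s)
  have hm : Measurable (fun q : EE d × EE d => 
      (u q.1 - u q.2) ^ 2 * kk ((d:ℝ) + 2 * s) (q.1 - q.2)) := by fun_prop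
  have hnn : ∀ q : EE d × EE d, 0 ≤ (u q.1 - u q.2) ^ 2 * kk ((d:ℝ) + 2 * s) (q.1 - q.2) :=
    fun q => mul_nonneg (sq_nonneg _) (kk_nonneg _ _)
  have hJ' : Js d s u (ball (0 : EE d) 1) = ∫⁻ q in OmS d, ENNReal.ofReal
      ((u q.1 - u q.2) ^ 2 * kk ((d:ℝ) + 2 * s) (q.1 - q.2)) := rfl
  rw [hJ'] at hJ ⊢
  constructor
  · rw [integrable_indicator_iff (OmS_meas d)]
    refine ⟨hm.aestronglyMeasurable, ?_⟩
    rw [hasFiniteIntegral_iff_ofReal (Filter.Eventually.of_forall hnn)]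
    exact lt_top_iff_ne_top.2 hJ
  · rw [integral_indicator (OmS_meas d), integral_eq_lintegral_of_nonneg_ae
      (Filter.Eventually.of_forall hnn) hm.aestronglyMeasurable]

lemma N_est {d : ℕ} (hd : 1 ≤ d) {s : ℝ} (hs0 : 0 < s) (hs1 : s < 1) :
    ∃ C : ℝ, 0 ≤ C ∧ ∀ (u : EE d → ℝ) (A : ℝ), LocL u A → ∀ h : EE d, ‖h‖ ≤ 1/4 → 
      Js d s u (ball (0 : EE d) 1) ≠ ⊤ →
      ∫ q : EE d × EE d, ((u (q.1 + h) - u q.1) * (u (q.2 + h) - u q.2)) * 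
        ((cut q.1 - cut q.2)^2 * kk ((d:ℝ) + 2 * s) (q.1 - q.2)) ≤
      C * ‖h‖ ^ 2 * (Js d s u (ball (0 : EE d) 1)).toReal +
      C * A ^ 2 * ‖h‖ ^ 2 * ∫ z : EE d, lam ((d:ℝ) + 2 * s) ‖h‖ z := by
  set p := (d:ℝ) + 2 * s with hp
  obtain ⟨C, hC0, hC⟩ := TT_far (d := d) p
  set V := ∫ x : EE d, ind2 x with hV
  have hV0 : 0 ≤ V := integral_nonneg fun x => ind2_nonneg x
  refine ⟨C + 2048 * V, by positivity, fun u A hu h hh hJ => ?_⟩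
  have huc := hu.cont
  have hinv : (volume : Measure (EE d × EE d)).IsAddRightInvariant :=
    inferInstanceAs ((volume : Measure (EE d)).prod volume).IsAddRightInvariant
  have hbd : ∀ x y, |(u x - u y) ^ 2| ≤ (2 * A) ^ 2 := fun x y => by
    rw [abs_pow]
    have a := abs_le.1 (hu.bdd x); have b := abs_le.1 (hu.bdd y)
    have : |u x - u y| ≤ 2 * A := by rw [abs_le]; constructor <;> linarith
    gcongr
  have iG : ∀ a b : EE d, Integrable (fun q : EE d × EE d => 
      (u (q.1 + a) - u (q.2 + b)) ^ 2 * GG p q.1 q.2) := fun a b =>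
    N_integrable hd hs0 hs1 (D := fun q : EE d × EE d => (u (q.1 + a) - u (q.2 + b)) ^ 2)
      (by fun_prop) (A := (2 * A) ^ 2) (fun q => hbd _ _)
  have iG2 : ∀ a b : EE d, Integrable (fun q : EE d × EE d => 
      (u q.1 - u q.2) ^ 2 * GG p (q.1 - a) (q.2 - b)) := fun a b => by
    have := (iG a b).comp_sub_right (a, b)
    refine this.congr (Filter.Eventually.of_forall fun q => ?_)
    simp
  have tr : ∀ a b : EE d, ∫ q : EE d × EE d, (u (q.1 + a) - u (q.2 + b)) ^ 2 * GG p q.1 q.2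
      = ∫ q : EE d × EE d, (u q.1 - u q.2) ^ 2 * GG p (q.1 - a) (q.2 - b) := fun a b => by
    rw [← integral_sub_right_eq_self _ ((a, b) : EE d × EE d)]
    simp
  have e1 : ∫ q : EE d × EE d, ((u (q.1 + h) - u q.1) * (u (q.2 + h) - u q.2)) * 
        ((cut q.1 - cut q.2)^2 * kk p (q.1 - q.2)) = 
      -(1/2) * ∫ q : EE d × EE d, (u q.1 - u q.2) ^ 2 * TT p h q.1 q.2 := by
    have r1 : ∫ q : EE d × EE d, ((u (q.1 + h) - u q.1) * (u (q.2 + h) - u q.2)) * 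
        ((cut q.1 - cut q.2)^2 * kk p (q.1 - q.2)) = 
        ∫ q : EE d × EE d, -(1/2) * ((u (q.1 + 0) - u (q.2 + 0)) ^ 2 * GG p q.1 q.2
          + (u (q.1 + h) - u (q.2 + h)) ^ 2 * GG p q.1 q.2
          - (u (q.1 + h) - u (q.2 + 0)) ^ 2 * GG p q.1 q.2
          - (u (q.1 + 0) - u (q.2 + h)) ^ 2 * GG p q.1 q.2) := by
      congr 1; ext q
      simp only [add_zero, GG]; ring
    have r2 : ∫ q : EE d × EE d, (u q.1 - u q.2) ^ 2 * TT p h q.1 q.2 = 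
        ∫ q : EE d × EE d, ((u q.1 - u q.2) ^ 2 * GG p (q.1 - 0) (q.2 - 0)
          + (u q.1 - u q.2) ^ 2 * GG p (q.1 - h) (q.2 - h)
          - (u q.1 - u q.2) ^ 2 * GG p (q.1 - h) (q.2 - 0)
          - (u q.1 - u q.2) ^ 2 * GG p (q.1 - 0) (q.2 - h)) := by
      congr 1; ext q
      simp only [sub_zero, TT]; ring
    rw [r1, r2, integral_const_mul]
    congr 1
    have spl : ∀ f1 f2 f3 f4 : EE d × EE d → ℝ, Integrable f1 → Integrable f2 →
        Integrable f3 → Integrable f4 → ∫ q, (f1 q + f2 q - f3 q - f4 q) =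
        (∫ q, f1 q) + (∫ q, f2 q) - (∫ q, f3 q) - ∫ q, f4 q := by
      intro f1 f2 f3 f4 h1 h2 h3 h4
      have a := integral_sub ((h1.add h2).sub h3) h4
      have b := integral_sub (h1.add h2) h3
      simp only [Pi.sub_apply, Pi.add_apply] at a b
      rw [a, b, integral_add h1 h2]
    rw [spl _ _ _ _ (iG 0 0) (iG h h) (iG h 0) (iG 0 h),
      spl _ _ _ _ (iG2 0 0) (iG2 h h) (iG2 h 0) (iG2 0 h), tr, tr, tr, tr]
  obtain ⟨jI, jE⟩ := Js_int (s := s) huc hJ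
  rw [← hp] at jI jE
  obtain ⟨lI, lE⟩ := lamsum_integrable hd hs0 hs1 h
  rw [← hp] at lI lE
  have kI := integrable_prod_sub' ind2_integrable lI
  have kE := integral_prod_sub_eq ind2_integrable lI
  rw [lE] at kE
  have bnd := norm_integral_le_of_norm_le
    (f := fun q : EE d × EE d => (u q.1 - u q.2) ^ 2 * TT p h q.1 q.2)
    ((jI.const_mul (C * ‖h‖ ^ 2)).add (kI.const_mul (1024 * A ^ 2 * ‖h‖ ^ 2)))
    (Filter.Eventually.of_forall fun q => ?_)
  · simp only [Pi.add_apply] at bnd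
    rw [integral_add (jI.const_mul (C * ‖h‖ ^ 2)) (kI.const_mul (1024 * A ^ 2 * ‖h‖ ^ 2)),
      integral_const_mul, integral_const_mul, jE, kE, ← hV] at bnd
    rw [e1]
    set Λ := ∫ z : EE d, lam p ‖h‖ z
    have hΛ : 0 ≤ Λ := integral_nonneg fun z => lam_nonneg _ _ _
    set J := (Js d s u (ball (0 : EE d) 1)).toReal
    have hJ0 : 0 ≤ J := ENNReal.toReal_nonneg
    have := (abs_le.1 bnd).1
    have q1 : 0 ≤ C * ‖h‖ ^ 2 * J := by positivity
    have q2 : 0 ≤ V * ‖h‖ ^ 2 * J := by positivity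
    have q3 : 0 ≤ C * A ^ 2 * ‖h‖ ^ 2 * Λ := by positivity
    nlinarith
  · simp only [Pi.add_apply]
    rw [norm_mul, Real.norm_of_nonneg (sq_nonneg _), Real.norm_eq_abs]
    have hj0 : 0 ≤ C * ‖h‖ ^ 2 * (OmS d).indicator (fun q : EE d × EE d => 
      (u q.1 - u q.2) ^ 2 * kk p (q.1 - q.2)) q := mul_nonneg (by positivity) 
        (indicator_nonneg (fun q _ => mul_nonneg (sq_nonneg _) (kk_nonneg _ _)) _)
    have hk0 : 0 ≤ 1024 * A ^ 2 * ‖h‖ ^ 2 * (ind2 q.1 * 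
      (2 * lam p ‖h‖ (q.1 - q.2) + lam p ‖h‖ (q.1 - q.2 - h) + lam p ‖h‖ (q.1 - q.2 + h))) := by
      have := ind2_nonneg q.1
      have := lam_nonneg p ‖h‖ (q.1 - q.2)
      have := lam_nonneg p ‖h‖ (q.1 - q.2 - h)
      have := lam_nonneg p ‖h‖ (q.1 - q.2 + h)
      positivity
    by_cases hO : q ∈ OmS d
    · by_cases hxy : q.1 = q.2
      · rw [hxy, sub_self]
        rw [hxy] at hk0
        have : (0:ℝ) ^ 2 * |TT p h q.2 q.2| = 0 := by simp
        rw [this]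
        simp only [sub_self] at hk0 ⊢
        linarith
      by_cases hfar : 4 * ‖h‖ ≤ ‖q.1 - q.2‖
      · rw [indicator_of_mem hO] at hj0 ⊢
        have := mul_le_mul_of_nonneg_left (hC h q.1 q.2 hxy hfar) (sq_nonneg (u q.1 - u q.2))
        nlinarith
      · push Not at hfar
        have hT := TT_near p hh hfar
        have hball : q.1 ∈ ball (0 : EE d) 2 ∧ q.2 ∈ ball (0 : EE d) 2 := by
          have n1 := norm_le_norm_add_norm_sub q.1 q.2
          have n2 := norm_le_norm_add_norm_sub q.2 q.1
          rw [norm_sub_rev] at n2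
          have : ‖q.1‖ < 1 ∨ ‖q.2‖ < 1 := by
            by_contra! hc
            apply hO
            simp [hc]
          simp only [mem_ball_zero_iff]
          rcases this with h | h <;> constructor <;> linarith
        have hl := hu.lip q.1 hball.1 q.2 hball.2
        have hA := hu.nonneg
        have hl2 : (u q.1 - u q.2) ^ 2 ≤ 16 * A ^ 2 * ‖h‖ ^ 2 := by
          rw [← sq_abs]
          calc _ ≤ (A * (4 * ‖h‖)) ^ 2 := by
                have : A * ‖q.1 - q.2‖ ≤ A * (4 * ‖h‖) := mul_le_mul_of_nonneg_left hfar.le hA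
                have := hl.trans this
                gcongr
            _ = _ := by ring
        have := mul_le_mul hl2 hT (abs_nonneg _) (by positivity)
        linarith
    · have hO' : q.1 ∉ ball (0 : EE d) 1 ∧ q.2 ∉ ball (0 : EE d) 1 := by
        simpa [OmS] using hO
      rw [TT_zero p hh hO'.1 hO'.2]
      simp only [abs_zero, mul_zero]
      linarith


lemma taylor_est {f f' : ℝ → ℝ} {α Cα : ℝ} (hα : 0 < α) (hC : 0 ≤ Cα)
    (hf : ∀ x ∈ Set.Icc (-1 : ℝ) 1, HasDerivAt f (f' x) x)
    (hH : ∀ x ∈ Set.Icc (-1 : ℝ) 1, ∀ y ∈ Set.Icc (-1 : ℝ) 1, |f' x - f' y| ≤ Cα * |x - y| ^ α)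
    {a b : ℝ} (ha : a ∈ Set.Icc (-1 : ℝ) 1) (hb : b ∈ Set.Icc (-1 : ℝ) 1) :
    |f b - f a - f' a * (b - a)| ≤ Cα * |b - a| ^ α * |b - a| := by
  have hsub : uIcc a b ⊆ Set.Icc (-1 : ℝ) 1 := uIcc_subset_Icc ha hb
  have := Convex.norm_image_sub_le_of_norm_hasDerivWithin_le (𝕜 := ℝ)
    (f := fun t => f t - f' a * t) (f' := fun t => f' t - f' a) (s := uIcc a b)
    (C := Cα * |b - a| ^ α) (x := a) (y := b) (fun t ht => by
      have := ((hf t (hsub ht)).sub ((hasDerivAt_id t).const_mul (f' a))).hasDerivWithinAt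
        (s := uIcc a b)
      rw [mul_one] at this
      exact this) (fun t ht => by
      refine (hH t (hsub ht) a ha).trans ?_
      have : |t - a| ≤ |b - a| := abs_sub_left_of_mem_uIcc ht
      have := Real.rpow_le_rpow (abs_nonneg _) this hα.le
      gcongr) (convex_uIcc a b) left_mem_uIcc right_mem_uIcc
  refine le_trans (le_of_eq ?_) this
  rw [Real.norm_eq_abs]; congr 1; ring

lemma cut_mul_int {d : ℕ} {G : EE d → ℝ} (hG : Continuous G) :
    Integrable (fun x => cut x * G x) := by
  have hcc := (cut_lip (d := d)).cont
  exact Continuous.integrable_of_hasCompactSupport (by fun_prop) (HasCompactSupport.mul_right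
     (HasCompactSupport.intro (isCompact_closedBall (0 : EE d) 1) fun x hx => cut_lip.supp x fun h => 
      hx (ball_subset_closedBall h)))

lemma lower {d : ℕ} {p : ℝ} (hp : 0 ≤ p) {U : EE d → ℝ} (hU : Continuous U)
    (hP : Integrable (fun q : EE d × EE d => cut q.1 * cut q.2 * (|U q.1| * |U q.2| - U q.1 * U q.2) *
      kk p (q.1 - q.2))) :
    (∫ x, cut x * |U x|) ^ 2 - (∫ x, cut x * U x) ^ 2 ≤ 2 ^ p * 
      ∫ q : EE d × EE d, cut q.1 * cut q.2 * (|U q.1| * |U q.2| - U q.1 * U q.2) *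
      kk p (q.1 - q.2) := by
  have i1 := cut_mul_int hU.abs
  have i2 := cut_mul_int hU
  have e1 := integral_prod_mul (μ := (volume : Measure (EE d))) (ν := (volume : Measure (EE d)))
    (fun x => cut x * |U x|) (fun x => cut x * |U x|)
  have e2 := integral_prod_mul (μ := (volume : Measure (EE d))) (ν := (volume : Measure (EE d)))
    (fun x => cut x * U x) (fun x => cut x * U x)
  rw [pow_two, pow_two, ← e1, ← e2, ← integral_sub (i1.mul_prod i1) (i2.mul_prod i2), 
    ← integral_const_mul]
  refine integral_mono ((i1.mul_prod i1).sub (i2.mul_prod i2)) (hP.const_mul _) fun q => ?_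
  simp only
  have hn : 0 ≤ |U q.1| * |U q.2| - U q.1 * U q.2 := by
    rw [← abs_mul]; linarith [le_abs_self (U q.1 * U q.2)]
  by_cases h1 : q.1 ∈ ball (0 : EE d) (3/4)
  swap
  · simp [cut_zero h1]
  by_cases h2 : q.2 ∈ ball (0 : EE d) (3/4)
  swap
  · simp [cut_zero h2]
  by_cases hxy : q.1 = q.2
  · rw [hxy]
    have := abs_mul_abs_self (U q.2)
    rw [this, sub_self, mul_zero, zero_mul, mul_zero]
    have : cut q.2 * |U q.2| * (cut q.2 * |U q.2|) = cut q.2 * U q.2 * (cut q.2 * U q.2) := by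
      linear_combination cut q.2 ^ 2 * this
    linarith
  have hpos : 0 < ‖q.1 - q.2‖ := norm_pos_iff.2 (sub_ne_zero.2 hxy)
  have h2' : ‖q.1 - q.2‖ ≤ 2 := by
    have := norm_sub_le q.1 q.2
    rw [mem_ball_zero_iff] at h1 h2
    linarith
  have hk : 1 ≤ 2 ^ p * kk p (q.1 - q.2) := by
    unfold kk
    rw [← div_eq_mul_inv, one_le_div (Real.rpow_pos_of_pos hpos _)]
    exact Real.rpow_le_rpow hpos.le h2' hp
  have hX : 0 ≤ cut q.1 * cut q.2 * (|U q.1| * |U q.2| - U q.1 * U q.2) :=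
    mul_nonneg (mul_nonneg (cut_nonneg _) (cut_nonneg _)) hn
  have := mul_le_mul_of_nonneg_left hk hX
  nlinarith

lemma cut_shift {d : ℕ} {u : EE d → ℝ} (hu : Continuous u) (hb : ∀ x, |u x| ≤ 1) {h : EE d} 
    (hh : ‖h‖ ≤ 1/4) :
    |∫ x, cut x * (u (x + h) - u x)| ≤ 4 * ‖h‖ * ∫ x : EE d, ind x := by
  have i1 := cut_mul_int (G := fun x => u (x + h)) (by fun_prop)
  have i2 := cut_mul_int hu
  have i3 : Integrable (fun x => cut (x - h) * u x) := by
    refine (i1.comp_sub_right h).congr (Filter.Eventually.of_forall fun x => ?_)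
    simp
  have e : ∫ x, cut x * (u (x + h) - u x) = ∫ x, (cut (x - h) - cut x) * u x := by
    simp only [mul_sub, sub_mul]
    rw [integral_sub i1 i2, integral_sub i3 i2]
    congr 1
    rw [← integral_sub_right_eq_self _ h]
    simp
  rw [e, ← integral_const_mul, ← Real.norm_eq_abs]
  refine norm_integral_le_of_norm_le (ind_integrable.const_mul _) 
    (Filter.Eventually.of_forall fun x => ?_)
  rw [norm_mul, Real.norm_eq_abs, Real.norm_eq_abs]
  by_cases hx : x ∈ ball (0 : EE d) 1
  · rw [ind_eq_one hx]
    have := cut_lip.lip (x - h) x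
    rw [sub_sub_cancel_left, norm_neg] at this
    exact mul_le_mul this (hb x) (abs_nonneg _) (by positivity)
  · have h1 : cut x = 0 := cut_lip.supp x hx
    have h2 : cut (x - h) = 0 := by
      apply cut_zero
      simp only [mem_ball_zero_iff, not_lt] at hx ⊢
      have := norm_le_norm_add_norm_sub h x
      have := norm_sub_norm_le x h
      linarith
    rw [h1, h2]
    have := ind_nonneg x
    simp; positivity

lemma fracC_pos (d : ℕ) {s : ℝ} (hs0 : 0 < s) (hs1 : s < 1) : 0 < fracC d s := by
  unfold fracC
  have h1 : 0 < Real.Gamma ((d : ℝ)/2 + s) := Real.Gamma_pos_of_pos (by positivity)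
  have h2 : Real.Gamma (-s) ≠ 0 := by
    apply Real.Gamma_ne_zero
    intro m hm
    have : s = (m:ℝ) := by linarith
    rcases Nat.eq_zero_or_pos m with h | h
    · rw [h] at this; simp at this; linarith
    · have : (1:ℝ) ≤ m := by exact_mod_cast h
      linarith
  have := abs_pos.2 h2
  have := Real.pi_pos
  positivity

lemma main_est {d : ℕ} (hd : 1 ≤ d) {s : ℝ} (hs0 : 0 < s) (hs1 : s < 1) :
    ∃ K : ℝ, 0 ≤ K ∧ ∀ (α Cα : ℝ) (f f' : ℝ → ℝ) (u : EE d → ℝ) (A : ℝ), 0 < α → 0 ≤ Cα → 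
      (∀ x ∈ Set.Icc (-1 : ℝ) 1, HasDerivAt f (f' x) x) →
      (∀ x ∈ Set.Icc (-1 : ℝ) 1, ∀ y ∈ Set.Icc (-1 : ℝ) 1, |f' x - f' y| ≤ Cα * |x - y| ^ α) →
      IsStableSolution d s f f' u → 1 ≤ A →
      (∀ x ∈ closedBall (0 : EE d) 3, ∀ y ∈ closedBall (0 : EE d) 3, |u x - u y| ≤ A * ‖x - y‖) →
      Js d s u (ball (0 : EE d) 1) ≠ ⊤ → ∀ h : EE d, ‖h‖ ≤ 1/4 →
      (∫ x, cut x * |u (x + h) - u x|) ^ 2 ≤ 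
        K * ‖h‖ ^ 2 * (1 + (Js d s u (ball (0 : EE d) 1)).toReal) +
        K * A ^ 2 * ‖h‖ ^ 2 * (∫ z : EE d, lam ((d:ℝ) + 2 * s) ‖h‖ z) + 
        K * Cα * (A * ‖h‖) ^ α * A ^ 2 * ‖h‖ ^ 2 := by
  obtain ⟨C, hC0, hN⟩ := N_est hd hs0 hs1
  set p := (d:ℝ) + 2 * s with hp
  have hp0 : 0 ≤ p := by positivity
  set V := ∫ x : EE d, ind x with hV
  have hV0 : 0 ≤ V := integral_nonneg ind_nonneg
  have hfc := fracC_pos d hs0 hs1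
  set c := fracC d s / 2 with hc
  have hc0 : 0 < c := by positivity
  have h2p : (0:ℝ) < 2 ^ p := by positivity
  refine ⟨2 ^ p * C + 16 * V ^ 2 + 2 ^ p * c⁻¹ * V, by positivity, ?_⟩
  intro α Cα f f' u A hα hCα hf hH hst hA hL hJ h hh
  obtain ⟨hu2, hub, heq, hstab⟩ := hst
  have hmem : ∀ x, u x ∈ Set.Icc (-1:ℝ) 1 := fun x => abs_le.1 (hub x)
  have huc := hu2.continuous
  have hfc : ContinuousOn f (Set.Icc (-1:ℝ) 1) := fun x hx => (hf x hx).continuousAt.continuousWithinAt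
  have hfc' : ContinuousOn f' (Set.Icc (-1:ℝ) 1) := by
    intro x hx
    have : Filter.Tendsto (fun y => Cα * |y - x| ^ α) (𝓝[Set.Icc (-1:ℝ) 1] x) (𝓝 0) := by
      have hcont : Continuous (fun y : ℝ => Cα * |y - x| ^ α) := by
        have : Continuous (fun y : ℝ => |y - x| ^ α) := 
          (by fun_prop : Continuous fun y : ℝ => |y - x|).rpow_const fun _ => Or.inr hα.le
        fun_prop
      have := (hcont.tendsto x).mono_left (nhdsWithin_le_nhds (s := Set.Icc (-1:ℝ) 1))
      simpa [Real.zero_rpow hα.ne'] using this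
    rw [ContinuousWithinAt, tendsto_iff_dist_tendsto_zero]
    refine squeeze_zero' (Filter.Eventually.of_forall fun _ => dist_nonneg) ?_ this
    filter_upwards [self_mem_nhdsWithin] with y hy
    exact hH y hy x hx
  have hb23 : ∀ x ∈ ball (0 : EE d) 2, x ∈ closedBall (0 : EE d) 3 ∧ x + h ∈ closedBall (0 : EE d) 3 := by
    intro x hx
    rw [mem_ball_zero_iff] at hx
    rw [mem_closedBall_zero_iff, mem_closedBall_zero_iff]
    have := norm_add_le x h
    constructor <;> linarith
  have lu : LocL u A := ⟨huc, fun x => (hub x).trans hA, fun x hx y hy => 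
    hL x (hb23 x hx).1 y (hb23 y hy).1⟩
  have lv : LocL (fun x => u (x + h)) A := ⟨by fun_prop, fun x => (hub _).trans hA, fun x hx y hy => by
    have := hL _ (hb23 x hx).2 _ (hb23 y hy).2
    rwa [add_sub_add_right_eq_sub] at this⟩
  have hv2 : ContDiff ℝ 2 (fun x => u (x + h)) := by fun_prop
  obtain ⟨iP, hcomb⟩ := comb hd hs0 hs1 hc0 lu lv hu2 hv2 
    (F := fun x => f (u x)) (F' := fun x => f (u (x + h))) (g := fun x => f' (u x))
    (hfc.comp_continuous huc hmem) 
    (hfc.comp_continuous (f := fun x => u (x + h)) (by fun_prop) fun x => hmem _)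
    (hfc'.comp_continuous huc hmem) heq (fun x => by
      rw [← heq (x + h)]
      simp only [add_right_comm x _ h, ← sub_add_eq_add_sub]
      rfl) hstab
    (U := fun x => u (x + h) - u x) (fun x => rfl)
  rw [← hp] at iP hcomb
  have hlow := lower hp0 (U := fun x => u (x + h) - u x) (by fun_prop) iP
  have hsh := cut_shift huc hub hh
  rw [← hV] at hsh
  have hNe := hN u A lu h hh hJ
  have herr : ∫ x, cut x ^ 2 * (u (x + h) - u x) * 
      (f (u (x + h)) - f (u x) - f' (u x) * (u (x + h) - u x)) ≤ 
      Cα * (A * ‖h‖) ^ α * A ^ 2 * ‖h‖ ^ 2 * V := by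
    rw [hV, ← integral_const_mul]
    refine (Real.le_norm_self _).trans (norm_integral_le_of_norm_le (ind_integrable.const_mul _) 
      (Filter.Eventually.of_forall fun x => ?_))
    by_cases hx : x ∈ ball (0 : EE d) 1
    · rw [ind_eq_one hx, mul_one, norm_mul, norm_mul, Real.norm_eq_abs, Real.norm_eq_abs, Real.norm_eq_abs]
      have hUx : |u (x + h) - u x| ≤ A * ‖h‖ := by
        have hx2 := hb23 x (ball_subset_ball (by norm_num) hx)
        have := hL _ hx2.2 _ hx2.1
        rwa [add_sub_cancel_left] at this
      have ht := taylor_est hα hCα hf hH (hmem x) (hmem (x + h))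
      have hr := Real.rpow_le_rpow (abs_nonneg _) hUx hα.le
      have hc2 : |cut x ^ 2| ≤ 1 := by
        rw [abs_of_nonneg (sq_nonneg _)]
        exact pow_le_one₀ (cut_nonneg x) (cut_le_one x)
      have hAh : 0 ≤ A * ‖h‖ := by positivity
      have hR : 0 ≤ (A * ‖h‖) ^ α := Real.rpow_nonneg hAh _
      calc _ ≤ 1 * (A * ‖h‖) * (Cα * (A * ‖h‖) ^ α * (A * ‖h‖)) := by
            gcongr
            exact ht.trans (by gcongr)
        _ = _ := by ring
    · rw [cut_lip.supp x hx]
      have := ind_nonneg x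
      simp only [ne_eq, OfNat.ofNat_ne_zero, not_false_eq_true, zero_pow, zero_mul, norm_zero]
      positivity
  set J := (Js d s u (ball (0 : EE d) 1)).toReal
  have hJ0 : 0 ≤ J := ENNReal.toReal_nonneg
  set Λ := ∫ z : EE d, lam p ‖h‖ z
  have hΛ : 0 ≤ Λ := integral_nonneg fun z => lam_nonneg _ _ _
  have hR : 0 ≤ (A * ‖h‖) ^ α := by positivity
  set R := (A * ‖h‖) ^ α
  set E := ∫ x, cut x ^ 2 * (u (x + h) - u x) * 
      (f (u (x + h)) - f (u x) - f' (u x) * (u (x + h) - u x)) with hE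
  set P := ∫ q : EE d × EE d, cut q.1 * cut q.2 * (|u (q.1 + h) - u q.1| * |u (q.2 + h) - u q.2| - (u (q.1 + h) - u q.1) * (u (q.2 + h) - u q.2)) *
      kk p (q.1 - q.2) with hP
  set N := ∫ q : EE d × EE d, ((u (q.1 + h) - u q.1) * (u (q.2 + h) - u q.2)) * 
        ((cut q.1 - cut q.2)^2 * kk p (q.1 - q.2)) with hNdef
  set S := ∫ x, cut x * (u (x + h) - u x) with hS
  set T := ∫ x, cut x * |u (x + h) - u x| with hT
  have hci : 0 < c⁻¹ := inv_pos.2 hc0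
  have hS2 : S ^ 2 ≤ 16 * V ^ 2 * ‖h‖ ^ 2 := by
    rw [← sq_abs]
    calc _ ≤ (4 * ‖h‖ * V) ^ 2 := by gcongr
      _ = _ := by ring
  have hE2 : c⁻¹ * E ≤ c⁻¹ * (Cα * R * A ^ 2 * ‖h‖ ^ 2 * V) := by gcongr
  have hP2 : 2 * P ≤ C * ‖h‖ ^ 2 * J + C * A ^ 2 * ‖h‖ ^ 2 * Λ + c⁻¹ * (Cα * R * A ^ 2 * ‖h‖ ^ 2 * V) := by
    linarith
  have hY : 0 ≤ C * ‖h‖ ^ 2 * J + C * A ^ 2 * ‖h‖ ^ 2 * Λ + c⁻¹ * (Cα * R * A ^ 2 * ‖h‖ ^ 2 * V) := by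
    positivity
  have hP3 : P ≤ C * ‖h‖ ^ 2 * J + C * A ^ 2 * ‖h‖ ^ 2 * Λ + c⁻¹ * (Cα * R * A ^ 2 * ‖h‖ ^ 2 * V) := by
    linarith
  have hP4 := mul_le_mul_of_nonneg_left hP3 h2p.le
  have n1 : 0 ≤ 2 ^ p * C * ‖h‖ ^ 2 := by positivity
  have n2 : 0 ≤ (16 * V ^ 2 + 2 ^ p * c⁻¹ * V) * ‖h‖ ^ 2 * J := by positivity
  have n3 : 0 ≤ 2 ^ p * c⁻¹ * V * ‖h‖ ^ 2 := by positivity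
  have n4 : 0 ≤ (16 * V ^ 2 + 2 ^ p * c⁻¹ * V) * A ^ 2 * ‖h‖ ^ 2 * Λ := by positivity
  have n5 : 0 ≤ (2 ^ p * C + 16 * V ^ 2) * Cα * R * A ^ 2 * ‖h‖ ^ 2 := by positivity
  have : T ^ 2 ≤ 16 * V ^ 2 * ‖h‖ ^ 2 + 2 ^ p * (C * ‖h‖ ^ 2 * J + C * A ^ 2 * ‖h‖ ^ 2 * Λ + c⁻¹ * (Cα * R * A ^ 2 * ‖h‖ ^ 2 * V)) := by
    linarith
  refine this.trans ?_
  linear_combination n1 + n2 + n3 + n4 + n5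


lemma dir_est {d : ℕ} (hd : 1 ≤ d) {s : ℝ} (hs0 : 0 < s) (hs1 : s < 1) :
    ∃ K : ℝ, 0 ≤ K ∧ ∀ (α : ℝ) (f f' : ℝ → ℝ) (u : EE d → ℝ), 0 < α → IsC1Alpha f f' α → 
      IsStableSolution d s f f' u → 
      Js d s u (ball (0 : EE d) 1) ≠ ⊤ → ∀ e : EE d, ‖e‖ = 1 →
      ∫ x in ball (0 : EE d) (1/2), |fderiv ℝ u x e| ≤ 
        √(K * (1 + (Js d s u (ball (0 : EE d) 1)).toReal)) := by
  obtain ⟨K, hK, hm⟩ := main_est hd hs0 hs1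
  refine ⟨K, hK, fun α f f' u hα hf hst hJ e he => ?_⟩
  obtain ⟨hf1, Cα, hCα, hH⟩ := hf
  have hu2 := hst.1
  have huc := hu2.continuous
  obtain ⟨L, hL0, hL⟩ := loc_lip (hu2.of_le (by norm_num)) 3
  set A := max 1 L with hA
  have hL' : ∀ x ∈ closedBall (0 : EE d) 3, ∀ y ∈ closedBall (0 : EE d) 3, 
      |u x - u y| ≤ A * ‖x - y‖ := fun x hx y hy => 
    (hL x hx y hy).trans (by gcongr; exact le_max_right _ _)
  have hA1 : 1 ≤ A := le_max_left _ _
  set J := (Js d s u (ball (0 : EE d) 1)).toReal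
  set t : ℕ → ℝ := fun n => 1 / ((n:ℝ) + 8) with ht
  have ht0 : ∀ n, 0 < t n := fun n => by positivity
  have ht1 : ∀ n, t n ≤ 1/4 := fun n => by
    have : (0:ℝ) ≤ n := Nat.cast_nonneg n
    simp only [ht]
    apply one_div_le_one_div_of_le <;> linarith
  have htl : Filter.Tendsto t Filter.atTop (𝓝 0) := by
    have := (tendsto_natCast_atTop_atTop (R := ℝ)).atTop_add (tendsto_const_nhds (x := (8:ℝ)))
    exact (tendsto_const_nhds (x := (1:ℝ))).div_atTop this
  have hnorm : ∀ n, ‖t n • e‖ = t n := fun n => by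
    rw [norm_smul, he, mul_one, Real.norm_of_nonneg (ht0 n).le]
  set Q : ℕ → ℝ := fun n => K * (1 + J) + K * A ^ 2 * (∫ z : EE d, lam ((d:ℝ) + 2 * s) (t n) z) + 
        K * Cα * (A * t n) ^ α * A ^ 2 with hQ
  have hQl : Filter.Tendsto Q Filter.atTop (𝓝 (K * (1 + J))) := by
    have h1 := (lam_tendsto hd hs0 hs1 htl).const_mul (K * A ^ 2)
    have h2 : Filter.Tendsto (fun n => (A * t n) ^ α) Filter.atTop (𝓝 0) := by
      have := (htl.const_mul A).rpow_const (p := α) (Or.inr hα.le)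
      simpa [Real.zero_rpow hα.ne'] using this
    have h3 := ((tendsto_const_nhds (x := K * (1 + J))).add h1).add ((h2.const_mul (K * Cα)).mul_const (A ^ 2))
    simpa using h3
  set B := ball (0 : EE d) (1/2) with hB
  have hBm : volume B ≠ ⊤ := measure_ball_lt_top.ne
  have hest : ∀ n, ∫ x in B, |(t n)⁻¹ * (u (x + t n • e) - u x)| ≤ √(Q n) := by
    intro n
    have h0 := ht0 n
    have hn := hm α Cα f f' u A hα hCα hf1 hH hst hA1 hL' hJ (t n • e) (by rw [hnorm]; exact ht1 n)
    rw [hnorm] at hn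
    have hi : Integrable (fun x => cut x * |u (x + t n • e) - u x|) := 
      cut_mul_int (G := fun x => |u (x + t n • e) - u x|) (by fun_prop)
    have hle : ∫ x in B, |u (x + t n • e) - u x| ≤ ∫ x, cut x * |u (x + t n • e) - u x| := by
      calc _ = ∫ x in B, cut x * |u (x + t n • e) - u x| := by
            refine setIntegral_congr_fun measurableSet_ball fun x hx => ?_
            rw [cut_one hx, one_mul]
        _ ≤ _ := setIntegral_le_integral hi (Filter.Eventually.of_forall fun x => 
            mul_nonneg (cut_nonneg _) (abs_nonneg _))
    have e1 : ∫ x in B, |(t n)⁻¹ * (u (x + t n • e) - u x)| = 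
        (t n)⁻¹ * ∫ x in B, |u (x + t n • e) - u x| := by
      simp only [abs_mul, abs_of_pos (inv_pos.2 h0)]
      rw [integral_const_mul]
    rw [e1]
    apply Real.le_sqrt_of_sq_le
    have h00 : 0 ≤ ∫ x in B, |u (x + t n • e) - u x| := integral_nonneg fun x => abs_nonneg _
    rw [mul_pow, inv_pow, inv_mul_le_iff₀ (by positivity)]
    calc _ ≤ (∫ x, cut x * |u (x + t n • e) - u x|) ^ 2 := by gcongr
      _ ≤ _ := hn
      _ = _ := by simp only [hQ]; ring
  have hlim : Filter.Tendsto (fun n => ∫ x in B, |(t n)⁻¹ * (u (x + t n • e) - u x)|) Filter.atTop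
      (𝓝 (∫ x in B, |fderiv ℝ u x e|)) := by
    refine tendsto_integral_of_dominated_convergence (fun _ => A) ?_ ?_ ?_ ?_
    · intro n
      exact (by fun_prop : Continuous fun x => |(t n)⁻¹ * (u (x + t n • e) - u x)|).aestronglyMeasurable
    · exact integrableOn_const hBm
    · intro n
      filter_upwards [ae_restrict_mem measurableSet_ball] with x hx
      have h0 := ht0 n
      rw [mem_ball_zero_iff] at hx
      have := hL' (x + t n • e) (by
        rw [mem_closedBall_zero_iff]
        have := norm_add_le x (t n • e)
        rw [hnorm] at this
        linarith [ht1 n]) x (by rw [mem_closedBall_zero_iff]; linarith)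
      rw [add_sub_cancel_left, hnorm] at this
      rw [Real.norm_eq_abs, abs_abs, abs_mul, abs_of_pos (inv_pos.2 h0), inv_mul_le_iff₀ h0]
      linarith
    · refine Filter.Eventually.of_forall fun x => ?_
      have hdx : HasFDerivAt u (fderiv ℝ u x) x := (hu2.differentiable (by norm_num) x).hasFDerivAt
      have hline := hdx.hasLineDerivAt e
      have := hline.tendsto_slope_zero
      have ht' : Filter.Tendsto t Filter.atTop (𝓝[≠] 0) := 
        tendsto_nhdsWithin_iff.2 ⟨htl, Filter.Eventually.of_forall fun n => (ht0 n).ne'⟩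
      have := (this.comp ht').abs
      exact this
  exact le_of_tendsto_of_tendsto' hlim (Real.continuous_sqrt.continuousAt.tendsto.comp hQl) hest

lemma norm_clm_le {d : ℕ} (T : EE d →L[ℝ] ℝ) : 
    ‖T‖ ≤ ∑ i : Fin d, |T (EuclideanSpace.single i (1:ℝ))| := by
  refine T.opNorm_le_bound (Finset.sum_nonneg fun i _ => abs_nonneg _) fun x => ?_
  have hx : x = ∑ i : Fin d, x i • EuclideanSpace.single i (1:ℝ) := by
    ext j
    simp [Finset.sum_apply, Pi.single_apply]
  conv_lhs => rw [hx]
  rw [map_sum, Finset.sum_mul]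
  refine (norm_sum_le _ _).trans (Finset.sum_le_sum fun i _ => ?_)
  rw [map_smul, norm_smul, mul_comm]
  exact mul_le_mul_of_nonneg_left (PiLp.norm_apply_le x i) (abs_nonneg _)

/-- Let `d ≥ 1`, `0 < s < 1`, `f` be `C^{1,α}` with `α > max{0,1−2s}`, and
let `u` be a stable solution of `(−Δ)^s u = f(u)` in `ℝ^d` with `|u| ≤ 1`. Then there is
`C = C(d,s)` such that `∫_{B_{1/2}} |∇u| ≤ C·(1 + √(J^s(u,B₁)))`. -/
theorem stmt10 (d : ℕ) (hd : 1 ≤ d) (s : ℝ) (hs0 : 0 < s) (hs1 : s < 1) :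
    ∃ C : ℝ, 0 < C ∧ ∀ α : ℝ, max 0 (1 - 2*s) < α → ∀ f f' : ℝ → ℝ, IsC1Alpha f f' α →
      ∀ u : EuclideanSpace ℝ (Fin d) → ℝ, IsStableSolution d s f f' u →
      ENNReal.ofReal (∫ x in ball (0 : EuclideanSpace ℝ (Fin d)) (1/2), ‖fderiv ℝ u x‖) ≤
        ENNReal.ofReal C *
          (1 + (Js d s u (ball (0 : EuclideanSpace ℝ (Fin d)) 1)) ^ (1/2 : ℝ)) := by
  obtain ⟨K, hK, hm⟩ := dir_est hd hs0 hs1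
  refine ⟨d * √K + 1, by positivity, fun α hα f f' hf u hst => ?_⟩
  have hα0 : 0 < α := lt_of_le_of_lt (le_max_left _ _) hα
  by_cases hJ : Js d s u (ball (0 : EuclideanSpace ℝ (Fin d)) 1) = ⊤
  · rw [hJ, ENNReal.top_rpow_of_pos (by norm_num), add_top, ENNReal.mul_top]
    · exact le_top
    · rw [ne_eq, ENNReal.ofReal_eq_zero, not_le]; positivity
  have hm' := hm α f f' u hα0 hf hst hJ
  have hJ0 : 0 ≤ (Js d s u (ball (0 : EuclideanSpace ℝ (Fin d)) 1)).toReal := ENNReal.toReal_nonneg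
  rw [← ENNReal.ofReal_toReal hJ]
  generalize (Js d s u (ball (0 : EuclideanSpace ℝ (Fin d)) 1)).toReal = J at *
  rw [ENNReal.ofReal_rpow_of_nonneg hJ0 (by norm_num), ← Real.sqrt_eq_rpow, ← ENNReal.ofReal_one, 
    ← ENNReal.ofReal_add zero_le_one (Real.sqrt_nonneg _), ← ENNReal.ofReal_mul (by positivity)]
  apply ENNReal.ofReal_le_ofReal
  have hcd : Continuous (fderiv ℝ u) := hst.1.continuous_fderiv (by norm_num)
  have hint : ∀ g : EE d → ℝ, Continuous g → IntegrableOn g (ball (0 : EE d) (1/2)) := fun g hg =>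
    (hg.continuousOn.integrableOn_compact (isCompact_closedBall (0 : EE d) (1/2))).mono_set
      ball_subset_closedBall
  calc _ ≤ ∫ x in ball (0 : EE d) (1/2), ∑ i : Fin d, |fderiv ℝ u x (EuclideanSpace.single i (1:ℝ))| := 
        integral_mono (hint _ (by fun_prop)) (hint _ (by fun_prop)) fun x => norm_clm_le _
    _ = ∑ i : Fin d, ∫ x in ball (0 : EE d) (1/2), |fderiv ℝ u x (EuclideanSpace.single i (1:ℝ))| :=
        integral_finsetSum _ fun i _ => hint _ (by fun_prop)
    _ ≤ ∑ i : Fin d, √(K * (1 + J)) := Finset.sum_le_sum fun i _ => hm' _ (by simp)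
    _ = d * √(K * (1 + J)) := by simp
    _ ≤ (d * √K + 1) * (1 + √J) := by
      have h1 : √(1 + J) ≤ 1 + √J := by
        apply Real.sqrt_le_iff.2
        have := Real.sq_sqrt hJ0
        have := Real.sqrt_nonneg J
        constructor <;> nlinarith
      have h0 := Real.sqrt_nonneg J
      rw [Real.sqrt_mul hK]
      have : (d:ℝ) * (√K * √(1 + J)) ≤ d * (√K * (1 + √J)) := by gcongr
      linarith
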